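/- Let a normal-form feasible schedule of the constructed instance with makespan W be given in which the job processed on machine 2 with start time 0 belongs to B. Then machine 1 processes its jobs in the order λ_1, A_0, a^{(1)}, α^{(1)}, A_1, a^{(2)}, α^{(2)}, A_2, …, a^{(z)}, α^{(z)}, A_z, where between consecutive A-jobs exactly one job of a is followed by exactly one job of α; consequently σ(A_i) = iD² + (i+1)D³ + iD⁴ + iD⁵ + iD⁶ + (7zi+z)D⁷ + (i+1)D⁸ for all i ∈ {0,…,z}. -/

import Mathlib

/-- Jobs of the instance constructed from a 3-Partition instance with parameter `z`. -/
inductive Job (z : ℕ) : Type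
  | JA (i : Fin (z+1))
  | JB (i : Fin (z+1))
  | Ja (i : Fin z)
  | Jb (i : Fin z)
  | Jc (j : Fin (z+1))
  | Jα (i : Fin z)
  | Jβ (i : Fin z)
  | Jγ (j : Fin z)
  | Jδ (j : Fin z)
  | Jl1
  | Jl2
  | Jpart (i : Fin (3*z))
  deriving DecidableEq, Fintype

/-- Processing times of the constructed jobs (`γ_j`, `δ_j` use index `j ∈ {1,…,z}`,
represented by `j.val + 1` for `j : Fin z`). -/
def pJob (z D : ℕ) (ι : Fin (3*z) → ℕ) : Job z → ℕ
  | .JA _ => D^2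
  | .JB _ => D^3
  | .Ja _ => D^4 + D^6 + 3*z*D^7
  | .Jb _ => D^5 + D^6 + 3*z*D^7
  | .Jc j => (z + j.val)*D^7 + D^8
  | .Jα _ => D^3 + D^5 + 4*z*D^7 + D^8
  | .Jβ _ => D^2 + D^4 + (4*z-1)*D^7 + D^8
  | .Jγ j => D^5 + (3*z - (j.val+1))*D^7 - D
  | .Jδ j => D^4 + (3*z - (j.val+1))*D^7
  | .Jl1 => D^3 + z*D^7 + D^8
  | .Jl2 => D^2 + 2*z*D^7 + D^8
  | .Jpart i => ι i

/-- Machine requirements of the constructed jobs. -/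
def qJob (z : ℕ) : Job z → ℕ
  | .JA _ => 3
  | .JB _ => 3
  | .Ja _ => 2
  | .Jb _ => 2
  | .Jc _ => 2
  | _ => 1

/-- Feasibility of a schedule `(σ, ρ)` on machines `{1,…,m}`: every job gets `q j`
machines among `{1,…,m}`, and jobs sharing a machine have disjoint half-open intervals. -/
def Feasible {J : Type} (m : ℕ) (p q : J → ℕ) (σ : J → ℕ) (ρ : J → Finset ℕ) : Prop :=
  (∀ j, ρ j ⊆ Finset.Icc 1 m) ∧ (∀ j, (ρ j).card = q j) ∧
  (∀ j j', j ≠ j' → (ρ j ∩ ρ j').Nonempty →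
    σ j + p j ≤ σ j' ∨ σ j' + p j' ≤ σ j)

/-- Makespan of a schedule. -/
def makespan {J : Type} [Fintype J] (p σ : J → ℕ) : ℕ :=
  Finset.univ.sup fun j => σ j + p j

/-- The target makespan `W`. -/
def Wval (z D : ℕ) : ℕ :=
  (z+1)*(D^2 + D^3 + D^8) + z*(D^4 + D^5 + D^6) + z*(7*z+1)*D^7

/-- The 3-Partition instance `ι` is a Yes-instance. -/
def IsYes (z D : ℕ) (ι : Fin (3*z) → ℕ) : Prop :=
  ∃ f : Fin (3*z) → Fin z,
    ∀ k : Fin z, ∑ i ∈ Finset.univ.filter (fun i => f i = k), ι i = D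

/-- Jobs processed on machine 1 in a normal-form schedule: `A ∪ a ∪ α ∪ {λ₁}`. -/
def M1Jobs {z : ℕ} : Job z → Prop
  | .JA _ => True
  | .Ja _ => True
  | .Jα _ => True
  | .Jl1 => True
  | _ => False

/-- Jobs processed on machine 4 in a normal-form schedule: `B ∪ b ∪ β ∪ {λ₂}`. -/
def M4Jobs {z : ℕ} : Job z → Prop
  | .JB _ => True
  | .Jb _ => True
  | .Jβ _ => True
  | .Jl2 => True
  | _ => False

/-- Jobs processed on both machines 2 and 3: `A ∪ B ∪ c`. -/
def BothM23 {z : ℕ} : Job z → Prop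
  | .JA _ => True
  | .JB _ => True
  | .Jc _ => True
  | _ => False

/-- Jobs processed on exactly one of machines 2 and 3: `a ∪ b ∪ γ ∪ δ ∪ P`. -/
def OneM23 {z : ℕ} : Job z → Prop
  | .Ja _ => True
  | .Jb _ => True
  | .Jγ _ => True
  | .Jδ _ => True
  | .Jpart _ => True
  | _ => False

/-- Normal form of a schedule of the constructed instance. -/
def NormalForm {z : ℕ} (ρ : Job z → Finset ℕ) : Prop :=
  (∀ j, 1 ∈ ρ j ↔ M1Jobs j) ∧
  (∀ j, 4 ∈ ρ j ↔ M4Jobs j) ∧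
  (∀ j, BothM23 j → 2 ∈ ρ j ∧ 3 ∈ ρ j) ∧
  (∀ j, OneM23 j → ((2 ∈ ρ j) ↔ ¬ (3 ∈ ρ j)))

/-- `cnt p σ S i` = number of jobs of `S` finishing no later than the start of `i`
(the quantity `#ᵢ S`). -/
def cnt {z : ℕ} (p σ : Job z → ℕ) (S : Finset (Job z)) (i : Job z) : ℕ :=
  (S.filter fun j => σ j + p j ≤ σ i).card

def sA (z : ℕ) : Finset (Job z) := Finset.univ.image Job.JA
def sB (z : ℕ) : Finset (Job z) := Finset.univ.image Job.JB
def sa (z : ℕ) : Finset (Job z) := Finset.univ.image Job.Ja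
def sb (z : ℕ) : Finset (Job z) := Finset.univ.image Job.Jb
def sc (z : ℕ) : Finset (Job z) := Finset.univ.image Job.Jc
def sα (z : ℕ) : Finset (Job z) := Finset.univ.image Job.Jα
def sβ (z : ℕ) : Finset (Job z) := Finset.univ.image Job.Jβ
def sγ (z : ℕ) : Finset (Job z) := Finset.univ.image Job.Jγ
def sδ (z : ℕ) : Finset (Job z) := Finset.univ.image Job.Jδ

section Helpers

def FF {J : Type} (p σ : J → ℕ) (S : Finset J) (t : ℕ) : ℕ :=
  (S.filter fun j => σ j + p j ≤ t).card

def DJ {J : Type} (p σ : J → ℕ) (j j' : J) : Prop :=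
  σ j + p j ≤ σ j' ∨ σ j' + p j' ≤ σ j

theorem DJ.symm' {J : Type} {p σ : J → ℕ} {j j' : J} (h : DJ p σ j j') : DJ p σ j' j := Or.symm h

theorem FF_mono {J : Type} (p σ : J → ℕ) (S : Finset J) {t t' : ℕ} (h : t ≤ t') :
    FF p σ S t ≤ FF p σ S t' := by
  apply Finset.card_le_card
  intro j hj
  simp only [Finset.mem_filter] at hj ⊢
  exact ⟨hj.1, hj.2.trans h⟩

theorem FF_le_card {J : Type} (p σ : J → ℕ) (S : Finset J) (t : ℕ) :
    FF p σ S t ≤ S.card := Finset.card_filter_le _ _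

theorem FF_lt {J : Type} (p σ : J → ℕ) (S : Finset J) {t t' : ℕ}
    (h : FF p σ S t < FF p σ S t') : ∃ j ∈ S, t < σ j + p j ∧ σ j + p j ≤ t' := by
  by_contra! hc
  apply absurd h
  rw [not_lt]
  apply Finset.card_le_card
  intro j hj
  simp only [Finset.mem_filter] at hj ⊢
  refine ⟨hj.1, ?_⟩
  by_contra! h2
  have := hc j hj.1 h2
  omega

theorem FF_succ {J : Type} (p σ : J → ℕ) (S : Finset J) {t t' : ℕ} (htt : t ≤ t') {j : J}
    (hj : j ∈ S) (h1 : t < σ j + p j) (h2 : σ j + p j ≤ t') :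
    FF p σ S t + 1 ≤ FF p σ S t' := by
  apply Nat.succ_le_of_lt
  apply Finset.card_lt_card
  rw [Finset.ssubset_iff_of_subset]
  · refine ⟨j, by simp [hj, h2], by simp [h1]⟩
  · intro j hj
    simp only [Finset.mem_filter] at hj ⊢
    exact ⟨hj.1, hj.2.trans htt⟩

theorem FF_last {J : Type} (p σ : J → ℕ) (pos : ∀ j, 0 < p j) (S : Finset J)
    (hS : ∀ x ∈ S, ∀ y ∈ S, x ≠ y → DJ p σ x y) {t : ℕ} (h : 0 < FF p σ S t) :
    ∃ j ∈ S, σ j + p j ≤ t ∧ FF p σ S t ≤ FF p σ S (σ j) + 1 := by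
  classical
  obtain ⟨j, hj, hmax⟩ := Finset.exists_max_image _ (fun j => σ j + p j) (Finset.card_pos.1 h)
  simp only [Finset.mem_filter] at hj hmax
  refine ⟨j, hj.1, hj.2, ?_⟩
  unfold FF
  rw [← Nat.sub_le_iff_le_add, ← Finset.card_erase_of_mem (a := j) (by simp [hj])]
  apply Finset.card_le_card
  intro x hx
  simp only [Finset.mem_erase, Finset.mem_filter] at hx ⊢
  refine ⟨hx.2.1, ?_⟩
  rcases hS x hx.2.1 j hj.1 hx.1 with h1 | h1
  · exact h1
  · have := hmax x hx.2
    have := pos x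
    omega

theorem FF_next {J : Type} (p σ : J → ℕ) (pos : ∀ j, 0 < p j) (S : Finset J) {t : ℕ}
    (h : FF p σ S t < S.card) :
    ∃ j ∈ S, t < σ j + p j ∧ FF p σ S (σ j) ≤ FF p σ S t := by
  classical
  have hne : (S.filter fun j => t < σ j + p j).Nonempty := by
    by_contra hc
    rw [Finset.not_nonempty_iff_eq_empty, Finset.filter_eq_empty_iff] at hc
    have : FF p σ S t = S.card := by
      unfold FF
      rw [Finset.filter_true_of_mem]
      intro x hx
      have := hc hx
      omega
    omega
  obtain ⟨j, hj, hmin⟩ := Finset.exists_min_image _ (fun j => σ j) hne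
  simp only [Finset.mem_filter] at hj hmin
  refine ⟨j, hj.1, hj.2, ?_⟩
  apply Finset.card_le_card
  intro x hx
  simp only [Finset.mem_filter] at hx ⊢
  refine ⟨hx.1, ?_⟩
  by_contra! h2
  have := hmin x ⟨hx.1, h2⟩
  have := pos x
  omega

structure Sys {J : Type} (p σ : J → ℕ) (z : ℕ) (A B C a b α β L M : Finset J)
    (ak bk γk δk : Bool → Finset J) : Prop where
  pos : ∀ j, 0 < p j
  dAA : ∀ x ∈ A, ∀ y ∈ A, x ≠ y → DJ p σ x y
  dBB : ∀ x ∈ B, ∀ y ∈ B, x ≠ y → DJ p σ x y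
  daa : ∀ x ∈ a, ∀ y ∈ a, x ≠ y → DJ p σ x y
  dbb : ∀ x ∈ b, ∀ y ∈ b, x ≠ y → DJ p σ x y
  dAB : ∀ x ∈ A, ∀ y ∈ B, DJ p σ x y
  dAC : ∀ x ∈ A, ∀ y ∈ C, DJ p σ x y
  dBC : ∀ x ∈ B, ∀ y ∈ C, DJ p σ x y
  dAa : ∀ x ∈ A, ∀ y ∈ a, DJ p σ x y
  dAb : ∀ x ∈ A, ∀ y ∈ b, DJ p σ x y
  dBa : ∀ x ∈ B, ∀ y ∈ a, DJ p σ x y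
  dBb : ∀ x ∈ B, ∀ y ∈ b, DJ p σ x y
  dCa : ∀ x ∈ C, ∀ y ∈ a, DJ p σ x y
  dCb : ∀ x ∈ C, ∀ y ∈ b, DJ p σ x y
  ska : ∀ x ∈ a, ∃ k, x ∈ ak k
  skb : ∀ x ∈ b, ∃ k, x ∈ bk k
  iska : ∀ k, ∀ x ∈ ak k, x ∈ a
  iskb : ∀ k, ∀ x ∈ bk k, x ∈ b
  suma : ∀ t, FF p σ (ak true) t + FF p σ (ak false) t = FF p σ a t
  sumb : ∀ t, FF p σ (bk true) t + FF p σ (bk false) t = FF p σ b t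
  stA : ∀ x ∈ A, FF p σ B (σ x) = FF p σ C (σ x) ∧
    FF p σ C (σ x) = FF p σ α (σ x) + FF p σ L (σ x) ∧
    ∀ k, FF p σ (bk k) (σ x) + FF p σ (γk k) (σ x) = FF p σ α (σ x) ∧
      FF p σ (ak k) (σ x) + FF p σ (bk k) (σ x) = FF p σ a (σ x)
  stB : ∀ x ∈ B, FF p σ A (σ x) = FF p σ C (σ x) ∧
    FF p σ C (σ x) = FF p σ β (σ x) + FF p σ M (σ x) ∧
    ∀ k, FF p σ (ak k) (σ x) + FF p σ (δk k) (σ x) = FF p σ β (σ x) ∧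
      FF p σ (bk k) (σ x) + FF p σ (ak k) (σ x) = FF p σ b (σ x)
  sta : ∀ k, ∀ x ∈ ak k, FF p σ B (σ x) = FF p σ C (σ x) ∧
    FF p σ C (σ x) = FF p σ α (σ x) + FF p σ L (σ x) ∧
    FF p σ (ak k) (σ x) + FF p σ (δk k) (σ x) = FF p σ a (σ x) ∧
      FF p σ (ak k) (σ x) + FF p σ (bk k) (σ x) = FF p σ a (σ x)
  stb : ∀ k, ∀ x ∈ bk k, FF p σ A (σ x) = FF p σ C (σ x) ∧
    FF p σ C (σ x) = FF p σ β (σ x) + FF p σ M (σ x) ∧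
    FF p σ (bk k) (σ x) + FF p σ (γk k) (σ x) = FF p σ b (σ x) ∧
      FF p σ (bk k) (σ x) + FF p σ (ak k) (σ x) = FF p σ b (σ x)
  stC : ∀ x ∈ C, FF p σ (ak true) (σ x) + FF p σ (bk true) (σ x) =
    FF p σ (ak false) (σ x) + FF p σ (bk false) (σ x)
  cA : A.card = z + 1
  cB : B.card = z + 1
  ca : a.card = z
  cb : b.card = z
  cα : α.card = z
  cβ : β.card = z
  cL : L.card = 1
  cM : M.card = 1

variable {J : Type} {p σ : J → ℕ} {z : ℕ} {A B C a b α β L M : Finset J}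
    {ak bk γk δk : Bool → Finset J}

theorem Sys.swap (h : Sys p σ z A B C a b α β L M ak bk γk δk) :
    Sys p σ z B A C b a β α M L bk ak δk γk :=
  { pos := h.pos, dAA := h.dBB, dBB := h.dAA, daa := h.dbb, dbb := h.daa
    dAB := fun x hx y hy => (h.dAB y hy x hx).symm'
    dAC := h.dBC, dBC := h.dAC, dAa := h.dBb, dAb := h.dBa, dBa := h.dAb, dBb := h.dAa
    dCa := h.dCb, dCb := h.dCa, ska := h.skb, skb := h.ska, iska := h.iskb, iskb := h.iska
    suma := h.sumb, sumb := h.suma, stA := h.stB, stB := h.stA, sta := h.stb, stb := h.sta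
    stC := fun x hx => by have := h.stC x hx; omega
    cA := h.cB, cB := h.cA, ca := h.cb, cb := h.ca, cα := h.cβ, cβ := h.cα
    cL := h.cM, cM := h.cL }

theorem Sys.F1 (h : Sys p σ z A B C a b α β L M ak bk γk δk) {x : J} (hx : x ∈ A) :
    FF p σ a (σ x) = FF p σ b (σ x) ∧ FF p σ α (σ x) = FF p σ b (σ x) := by
  obtain ⟨h1, h2, h3⟩ := h.stA x hx
  have ht := h3 true
  have hf := h3 false
  have sa := h.suma (σ x)
  have sb := h.sumb (σ x)
  refine ⟨by omega, le_antisymm ?_ ?_⟩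
  · by_contra! hlt
    have hc : FF p σ b (σ x) < b.card := by
      have := FF_le_card p σ α (σ x)
      rw [h.cα] at this; rw [h.cb]; omega
    obtain ⟨j, hj, hj1, hj2⟩ := FF_next p σ h.pos b hc
    obtain ⟨k, hk⟩ := h.skb j hj
    obtain ⟨-, -, g3, -⟩ := h.stb k j hk
    have hle : σ x ≤ σ j := by
      rcases h.dAb x hx j hj with g | g <;> omega
    have m1 := FF_mono p σ (bk k) hle
    have m2 := FF_mono p σ (γk k) hle
    have := (h3 k).1
    omega
  · rcases Nat.eq_zero_or_pos (FF p σ b (σ x)) with h0 | h0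
    · omega
    obtain ⟨j, hj, hj1, hj2⟩ := FF_last p σ h.pos b h.dbb h0
    obtain ⟨k, hk⟩ := h.skb j hj
    obtain ⟨-, -, g3, -⟩ := h.stb k j hk
    have hp := h.pos j
    have hle : σ j ≤ σ x := by omega
    have m1 := FF_succ p σ (bk k) hle hk (by omega) hj1
    have m2 := FF_mono p σ (γk k) hle
    have := (h3 k).1
    omega

theorem Sys.F2aux (h : Sys p σ z A B C a b α β L M ak bk γk δk) {x : J} (hx : x ∈ C) :
    FF p σ b (σ x) ≤ FF p σ a (σ x) := by
  have h3 := h.stC x hx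
  have sa := h.suma (σ x)
  have sb := h.sumb (σ x)
  rcases Nat.eq_zero_or_pos (FF p σ b (σ x)) with h0 | h0
  · omega
  obtain ⟨j, hj, hj1, hj2⟩ := FF_last p σ h.pos b h.dbb h0
  obtain ⟨k, hk⟩ := h.skb j hj
  obtain ⟨-, -, -, g3⟩ := h.stb k j hk
  have hp := h.pos j
  have hle : σ j ≤ σ x := by omega
  have m1 := FF_succ p σ (bk k) hle hk (by omega) hj1
  have m2 := FF_mono p σ (ak k) hle
  cases k <;> omega

theorem Sys.F2 (h : Sys p σ z A B C a b α β L M ak bk γk δk) {x : J} (hx : x ∈ C) :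
    FF p σ a (σ x) = FF p σ b (σ x) := le_antisymm (h.swap.F2aux hx) (h.F2aux hx)

theorem Sys.Y (h : Sys p σ z A B C a b α β L M ak bk γk δk) {X X' : J} (hX : X ∈ B)
    (hX' : X' ∈ A) (hle : σ X ≤ σ X') (hA : FF p σ A (σ X') = FF p σ A (σ X))
    (hB : FF p σ C (σ X) ≤ FF p σ B (σ X)) :
    FF p σ a (σ X') = FF p σ a (σ X) := by
  have m := FF_mono p σ a hle
  have e1 := (h.swap.F1 hX).1
  have e2 := (h.F1 hX').1
  have eAC := (h.stB X hX).1
  have pX := h.pos X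
  by_contra hne
  obtain ⟨y, hy, hy1, hy2⟩ := FF_lt p σ b (t := σ X) (t' := σ X') (by omega)
  obtain ⟨x, hx, hx1, hx2⟩ := FF_lt p σ a (t := σ X) (t' := σ X') (by omega)
  -- any a-job ending after X starts has many C before
  have key : ∀ x ∈ a, σ X < σ x + p x → FF p σ C (σ X) + 1 ≤ FF p σ C (σ x) := by
    intro x hx hx1
    have hs : σ X + p X ≤ σ x := by rcases h.dBa X hX x hx with g | g <;> omega
    have := FF_succ p σ B (t := σ X) (t' := σ x) (by omega) hX (by omega) hs
    obtain ⟨k, hk⟩ := h.ska x hx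
    have := (h.sta k x hk).1
    omega
  have hys : σ X + p X ≤ σ y := by rcases h.dBb X hX y hy with g | g <;> omega
  have hyC : FF p σ C (σ y) = FF p σ C (σ X) := by
    obtain ⟨k, hk⟩ := h.skb y hy
    have := (h.stb k y hk).1
    have := FF_mono p σ A (t := σ X) (t' := σ y) (by omega)
    have := FF_mono p σ A (t := σ y) (t' := σ X') (by omega)
    omega
  have hc : FF p σ C (σ X) < C.card := by
    have := key x hx hx1
    have := FF_le_card p σ C (σ x)
    omega
  obtain ⟨c, hcC, hc1, hc2⟩ := FF_next p σ h.pos C hc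
  have hcs : σ X + p X ≤ σ c := by rcases h.dBC X hX c hcC with g | g <;> omega
  have hyc : σ y + p y ≤ σ c := by
    rcases h.dCb c hcC y hy with g | g
    · have := FF_succ p σ C (t := σ X) (t' := σ y) (by omega) hcC hc1 g
      omega
    · exact g
  have := FF_succ p σ b (t := σ X) (t' := σ c) (by omega) hy hy1 hyc
  have e3 := h.F2 hcC
  obtain ⟨x', hx', hx'1, hx'2⟩ := FF_lt p σ a (t := σ X) (t' := σ c) (by omega)
  have := key x' hx' hx'1
  have := FF_mono p σ C (t := σ x') (t' := σ c) (by omega)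
  omega

theorem Sys.base (h : Sys p σ z A B C a b α β L M ak bk γk δk) {x y : J} (hx : x ∈ A)
    (hy : y ∈ B) (h0 : σ y = 0) (hA : FF p σ A (σ x) = 0) :
    FF p σ B (σ x) = 1 ∧ FF p σ a (σ x) = 0 ∧ FF p σ α (σ x) = 0 ∧ FF p σ L (σ x) = 1 := by
  have z0 : ∀ S, FF p σ S 0 = 0 := by
    intro S
    unfold FF
    rw [Finset.card_eq_zero, Finset.filter_eq_empty_iff]
    intro j _
    have := h.pos j
    omega
  have e := h.Y hy hx (by omega) (by rw [hA, h0, z0]) (by rw [h0, z0, z0])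
  rw [h0, z0] at e
  have f := h.F1 hx
  obtain ⟨g1, g2, -⟩ := h.stA x hx
  have := h.pos x
  have := h.pos y
  have hs : σ y + p y ≤ σ x := by rcases h.dAB x hx y hy with g | g <;> omega
  have := FF_succ p σ B (t := 0) (t' := σ x) (by omega) hy (by omega) hs
  have hL := FF_le_card p σ L (σ x)
  rw [h.cL] at hL
  rw [z0] at this
  omega

theorem Sys.step (h : Sys p σ z A B C a b α β L M ak bk γk δk) {x x' : J} (hx : x ∈ A)
    (hx' : x' ∈ A) {i : ℕ} (hlt : σ x + p x ≤ σ x') (hA : FF p σ A (σ x) = i)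
    (hA' : FF p σ A (σ x') = i + 1) (hi : i + 1 ≤ z) (hB : FF p σ B (σ x) = i + 1)
    (ha : FF p σ a (σ x) = i) (hL : FF p σ L (σ x) = 1) :
    FF p σ B (σ x') = i + 2 ∧ FF p σ a (σ x') = i + 1 ∧ FF p σ α (σ x') = i + 1 ∧
    FF p σ L (σ x') = 1 ∧ ∃ y ∈ B, σ x + p x ≤ σ y ∧ σ y ≤ σ x' ∧ FF p σ B (σ y) = i + 1 ∧
      FF p σ a (σ y) = i + 1 := by
  have f := h.F1 hx
  have f' := h.F1 hx'
  obtain ⟨g1, g2, -⟩ := h.stA x hx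
  obtain ⟨g1', g2', -⟩ := h.stA x' hx'
  have hL' : FF p σ L (σ x') = 1 := by
    have := FF_le_card p σ L (σ x')
    have := FF_mono p σ L (t := σ x) (t' := σ x') (by omega)
    rw [h.cL] at *
    omega
  have pp := h.pos x
  have pp' := h.pos x'
  obtain ⟨y, hy, hy1, hy2⟩ := FF_next p σ h.pos B (t := σ x) (by rw [h.cB]; omega)
  have hys : σ x + p x ≤ σ y := by rcases h.dAB x hx y hy with g | g <;> omega
  have py := h.pos y
  have hBy : FF p σ B (σ y) = i + 1 := by
    have := FF_mono p σ B (t := σ x) (t' := σ y) (by omega)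
    omega
  obtain ⟨k1, k2, -⟩ := h.stB y hy
  have fy := h.swap.F1 hy
  have hM := FF_le_card p σ M (σ y)
  rw [h.cM] at hM
  rcases h.dAB x' hx' y hy with g | g
  · exfalso
    have hBx' : FF p σ B (σ x') = i + 1 := by
      have := FF_mono p σ B (t := σ x) (t' := σ x') (by omega)
      have := FF_mono p σ B (t := σ x') (t' := σ y) (by omega)
      omega
    have := FF_succ p σ A (t := σ x') (t' := σ y) (by omega) hx' (by omega) g
    have e := h.swap.Y hx' hy (by omega) (by omega) (by omega)
    omega
  · have hAy : FF p σ A (σ y) = i + 1 := by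
      have := FF_succ p σ A (t := σ x) (t' := σ y) (by omega) hx (by omega) hys
      have := FF_mono p σ A (t := σ y) (t' := σ x') (by omega)
      omega
    have e := h.Y hy hx' (by omega) (by omega) (by omega)
    have := FF_succ p σ B (t := σ y) (t' := σ x') (by omega) hy (by omega) g
    exact ⟨by omega, by omega, by omega, hL', y, hy, hys, by omega, hBy, by omega⟩

theorem Sys.final (h : Sys p σ z A B C a b α β L M ak bk γk δk) {x x' : J} (hx : x ∈ A)
    (hx' : x' ∈ A) {i : ℕ} (hlt : σ x + p x ≤ σ x') (hA : FF p σ A (σ x) = i)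
    (hA' : FF p σ A (σ x') = i + 1) (hi : i + 1 ≤ z) (hB : FF p σ B (σ x) = i + 1)
    (ha : FF p σ a (σ x) = i) (hα : FF p σ α (σ x) = i) (hL : FF p σ L (σ x) = 1)
    (daα : ∀ x ∈ a, ∀ y ∈ α, DJ p σ x y) :
    ∃ u ∈ a, ∃ v ∈ α, σ x + p x ≤ σ u ∧ σ u + p u ≤ σ v ∧ σ v + p v ≤ σ x' := by
  obtain ⟨q1, q2, q3, q4, y, hy, y1, y2, y3, y4⟩ := h.step hx hx' hlt hA hA' hi hB ha hL
  have pp := h.pos x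
  obtain ⟨u, hu, hu1, hu2⟩ := FF_lt p σ a (t := σ x) (t' := σ y) (by omega)
  obtain ⟨v, hv, hv1, hv2⟩ := FF_lt p σ α (t := σ x) (t' := σ x') (by omega)
  have pu := h.pos u
  have hus : σ x + p x ≤ σ u := by rcases h.dAa x hx u hu with g | g <;> omega
  refine ⟨u, hu, v, hv, hus, ?_, hv2⟩
  rcases daα u hu v hv with g | g
  · exact g
  · exfalso
    obtain ⟨k, hk⟩ := h.ska u hu
    obtain ⟨s1, s2, -⟩ := h.sta k u hk
    have := FF_mono p σ B (t := σ u) (t' := σ y) (by omega)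
    have := FF_mono p σ L (t := σ x) (t' := σ u) (by omega)
    have := FF_succ p σ α (t := σ x) (t' := σ u) (by omega) hv hv1 g
    omega

end Helpers
section Concrete

theorem packing {J : Type} [DecidableEq J] (p σ : J → ℕ) (S : Finset J)
    (hS : ∀ x ∈ S, ∀ y ∈ S, x ≠ y → DJ p σ x y) (u v : ℕ)
    (h : ∀ x ∈ S, u ≤ σ x ∧ σ x + p x ≤ v) : ∑ x ∈ S, p x ≤ v - u := by
  have h1 : (S.biUnion fun x => Finset.Ico (σ x) (σ x + p x)).card = ∑ x ∈ S, p x := by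
    rw [Finset.card_biUnion]
    · simp
    · intro x hx y hy hxy
      rw [Function.onFun, Finset.disjoint_left]
      intro t ht ht'
      simp only [Finset.mem_Ico] at ht ht'
      rcases hS x hx y hy hxy with g | g <;> omega
  rw [← h1, ← Nat.card_Ico]
  apply Finset.card_le_card
  intro t ht
  simp only [Finset.mem_biUnion, Finset.mem_Ico] at ht ⊢
  obtain ⟨x, hx, h2⟩ := ht
  have := h x hx
  omega

theorem digits_int (D e d2 d3 d4 d5 d6 d7 d8 : ℤ) (hD : 0 < D) (he : |e| < D^2)
    (h2 : |d2| < D) (h3 : |d3| < D) (h4 : |d4| < D) (h5 : |d5| < D) (h6 : |d6| < D)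
    (h7 : |d7| < D)
    (h : e + d2*D^2 + d3*D^3 + d4*D^4 + d5*D^5 + d6*D^6 + d7*D^7 + d8*D^8 = 0) :
    d2 = 0 ∧ d3 = 0 ∧ d4 = 0 ∧ d5 = 0 ∧ d6 = 0 ∧ d8 = 0 := by
  have hD0 : D ≠ 0 := hD.ne'
  have e0 : e = 0 := Int.eq_zero_of_abs_lt_dvd
    (⟨-(d2 + d3*D + d4*D^2 + d5*D^3 + d6*D^4 + d7*D^5 + d8*D^6), by linear_combination h⟩ : D^2 ∣ e) he
  subst e0
  have h' : d2 + d3*D + d4*D^2 + d5*D^3 + d6*D^4 + d7*D^5 + d8*D^6 = 0 := by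
    apply (mul_eq_zero.1 (by linear_combination h :
      D^2 * (d2 + d3*D + d4*D^2 + d5*D^3 + d6*D^4 + d7*D^5 + d8*D^6) = 0)).resolve_left
    positivity
  have a2 : d2 = 0 := Int.eq_zero_of_abs_lt_dvd
    (⟨-(d3 + d4*D + d5*D^2 + d6*D^3 + d7*D^4 + d8*D^5), by linear_combination h'⟩ : D ∣ d2) h2
  subst a2
  have h' : d3 + d4*D + d5*D^2 + d6*D^3 + d7*D^4 + d8*D^5 = 0 :=
    (mul_eq_zero.1 (by linear_combination h' :
      D * (d3 + d4*D + d5*D^2 + d6*D^3 + d7*D^4 + d8*D^5) = 0)).resolve_left hD0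
  have a3 : d3 = 0 := Int.eq_zero_of_abs_lt_dvd
    (⟨-(d4 + d5*D + d6*D^2 + d7*D^3 + d8*D^4), by linear_combination h'⟩ : D ∣ d3) h3
  subst a3
  have h' : d4 + d5*D + d6*D^2 + d7*D^3 + d8*D^4 = 0 :=
    (mul_eq_zero.1 (by linear_combination h' :
      D * (d4 + d5*D + d6*D^2 + d7*D^3 + d8*D^4) = 0)).resolve_left hD0
  have a4 : d4 = 0 := Int.eq_zero_of_abs_lt_dvd
    (⟨-(d5 + d6*D + d7*D^2 + d8*D^3), by linear_combination h'⟩ : D ∣ d4) h4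
  subst a4
  have h' : d5 + d6*D + d7*D^2 + d8*D^3 = 0 :=
    (mul_eq_zero.1 (by linear_combination h' :
      D * (d5 + d6*D + d7*D^2 + d8*D^3) = 0)).resolve_left hD0
  have a5 : d5 = 0 := Int.eq_zero_of_abs_lt_dvd
    (⟨-(d6 + d7*D + d8*D^2), by linear_combination h'⟩ : D ∣ d5) h5
  subst a5
  have h' : d6 + d7*D + d8*D^2 = 0 :=
    (mul_eq_zero.1 (by linear_combination h' :
      D * (d6 + d7*D + d8*D^2) = 0)).resolve_left hD0
  have a6 : d6 = 0 := Int.eq_zero_of_abs_lt_dvd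
    (⟨-(d7 + d8*D), by linear_combination h'⟩ : D ∣ d6) h6
  subst a6
  have h' : d7 + d8*D = 0 :=
    (mul_eq_zero.1 (by linear_combination h' : D * (d7 + d8*D) = 0)).resolve_left hD0
  have a7 : d7 = 0 := Int.eq_zero_of_abs_lt_dvd
    (⟨-d8, by linear_combination h'⟩ : D ∣ d7) h7
  subst a7
  have a8 : d8 = 0 :=
    (mul_eq_zero.1 (by linear_combination h' : D * d8 = 0)).resolve_left hD0
  exact ⟨rfl, rfl, rfl, rfl, rfl, a8⟩

theorem abs_sub_nat_lt (x y D : ℕ) (hx : x < D) (hy : y < D) : |((x:ℤ) - y)| < D := by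
  rw [abs_lt]; constructor <;> omega

def jobEquiv (z : ℕ) : Job z ≃ Fin (z+1) ⊕ Fin (z+1) ⊕ Fin z ⊕ Fin z ⊕ Fin (z+1) ⊕ Fin z ⊕
    Fin z ⊕ Fin z ⊕ Fin z ⊕ Unit ⊕ Unit ⊕ Fin (3*z) where
  toFun
    | .JA i => .inl i
    | .JB i => .inr (.inl i)
    | .Ja i => .inr (.inr (.inl i))
    | .Jb i => .inr (.inr (.inr (.inl i)))
    | .Jc i => .inr (.inr (.inr (.inr (.inl i))))
    | .Jα i => .inr (.inr (.inr (.inr (.inr (.inl i)))))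
    | .Jβ i => .inr (.inr (.inr (.inr (.inr (.inr (.inl i))))))
    | .Jγ i => .inr (.inr (.inr (.inr (.inr (.inr (.inr (.inl i)))))))
    | .Jδ i => .inr (.inr (.inr (.inr (.inr (.inr (.inr (.inr (.inl i))))))))
    | .Jl1 => .inr (.inr (.inr (.inr (.inr (.inr (.inr (.inr (.inr (.inl ())))))))))
    | .Jl2 => .inr (.inr (.inr (.inr (.inr (.inr (.inr (.inr (.inr (.inr (.inl ()))))))))))
    | .Jpart i => .inr (.inr (.inr (.inr (.inr (.inr (.inr (.inr (.inr (.inr (.inr i))))))))))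
  invFun
    | .inl i => .JA i
    | .inr (.inl i) => .JB i
    | .inr (.inr (.inl i)) => .Ja i
    | .inr (.inr (.inr (.inl i))) => .Jb i
    | .inr (.inr (.inr (.inr (.inl i)))) => .Jc i
    | .inr (.inr (.inr (.inr (.inr (.inl i))))) => .Jα i
    | .inr (.inr (.inr (.inr (.inr (.inr (.inl i)))))) => .Jβ i
    | .inr (.inr (.inr (.inr (.inr (.inr (.inr (.inl i))))))) => .Jγ i
    | .inr (.inr (.inr (.inr (.inr (.inr (.inr (.inr (.inl i)))))))) => .Jδ i
    | .inr (.inr (.inr (.inr (.inr (.inr (.inr (.inr (.inr (.inl _))))))))) => .Jl1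
    | .inr (.inr (.inr (.inr (.inr (.inr (.inr (.inr (.inr (.inr (.inl _)))))))))) => .Jl2
    | .inr (.inr (.inr (.inr (.inr (.inr (.inr (.inr (.inr (.inr (.inr i)))))))))) => .Jpart i
  left_inv j := by cases j <;> rfl
  right_inv j := by
    rcases j with i | i | i | i | i | i | i | i | i | i | i | i <;> rfl

theorem sum_job (z : ℕ) (g : Job z → ℕ) : ∑ j, g j =
    ∑ i, g (.JA i) + ∑ i, g (.JB i) + ∑ i, g (.Ja i) + ∑ i, g (.Jb i) + ∑ i, g (.Jc i)
    + ∑ i, g (.Jα i) + ∑ i, g (.Jβ i) + ∑ i, g (.Jγ i) + ∑ i, g (.Jδ i) + g .Jl1 + g .Jl2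
    + ∑ i, g (.Jpart i) := by
  rw [← Equiv.sum_comp (jobEquiv z).symm g]
  simp only [Fintype.sum_sum_type, Finset.univ_unique, Finset.sum_singleton]
  simp only [jobEquiv, Equiv.coe_fn_symm_mk, add_assoc]

def sPart (z : ℕ) : Finset (Job z) := Finset.univ.image Job.Jpart
def sl1 (z : ℕ) : Finset (Job z) := {Job.Jl1}
def sl2 (z : ℕ) : Finset (Job z) := {Job.Jl2}

theorem sum_job' (z : ℕ) (g : Job z → ℕ) (P : Job z → Prop) [DecidablePred P] :
    ∑ j ∈ Finset.univ.filter P, g j =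
    ∑ j ∈ (sA z).filter P, g j + ∑ j ∈ (sB z).filter P, g j + ∑ j ∈ (sa z).filter P, g j
    + ∑ j ∈ (sb z).filter P, g j + ∑ j ∈ (sc z).filter P, g j
    + ∑ j ∈ (sα z).filter P, g j + ∑ j ∈ (sβ z).filter P, g j + ∑ j ∈ (sγ z).filter P, g j
    + ∑ j ∈ (sδ z).filter P, g j + ∑ j ∈ (sl1 z).filter P, g j + ∑ j ∈ (sl2 z).filter P, g j
    + ∑ j ∈ (sPart z).filter P, g j := by
  simp only [Finset.sum_filter]
  rw [sum_job]
  simp only [sA, sB, sa, sb, sc, sα, sβ, sγ, sδ, sPart, sl1, sl2]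
  repeat rw [Finset.sum_image (by intro x _ y _ h; injection h)]
  simp only [Finset.sum_singleton]

theorem total_pq (z D : ℕ) (ι : Fin (3*z) → ℕ) (hz : 0 < z)
    (hsum : ∑ i, ι i = z * D) : ∑ j, pJob z D ι j * qJob z j = 4 * Wval z D := by
  rw [sum_job]
  simp only [pJob, qJob, Finset.sum_const, Finset.card_univ, Fintype.card_fin, smul_eq_mul, mul_one,
    hsum]
  rw [Fin.sum_univ_succ (f := fun i : Fin (z+1) => ((z + i.val) * D^7 + D^8) * 2)]
  have key : ∑ i : Fin z, ((z + (Fin.succ i).val) * D^7 + D^8) * 2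
      + ∑ i : Fin z, (D^5 + (3*z - (i.val+1))*D^7 - D) + ∑ i : Fin z, (D^4 + (3*z - (i.val+1))*D^7)
      + z * D = z * (D^4 + D^5 + 8*z*D^7 + 2*D^8) := by
    have : z * D = ∑ i : Fin z, D := by simp
    rw [this, ← Finset.sum_add_distrib, ← Finset.sum_add_distrib, ← Finset.sum_add_distrib]
    rw [Finset.sum_congr rfl (g := fun _ => D^4 + D^5 + 8*z*D^7 + 2*D^8)]
    · simp
    · intro i _
      have hi := i.isLt
      obtain ⟨w, hw⟩ : ∃ w, 3*z = w + (i.val+1) := ⟨3*z - (i.val+1), by omega⟩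
      have h5 : D ≤ D^5 := Nat.le_self_pow (by norm_num) D
      obtain ⟨v, hv⟩ : ∃ v, D^5 = v + D := ⟨D^5 - D, by omega⟩
      have e1 : 3*z - (i.val+1) = w := by omega
      rw [e1]
      have e2 : D^5 + w*D^7 - D = v + w*D^7 := by omega
      rw [e2, hv, Fin.val_succ]
      have : 8 * z = 2 * z + 2 * (w + (i.val+1)) := by omega
      rw [this]
      ring
  obtain ⟨y, rfl⟩ : ∃ y, z = y + 1 := ⟨z - 1, by omega⟩
  have e4 : 4 * (y+1) - 1 = 4 * y + 3 := by omega
  simp only [e4, Wval, Fin.val_zero]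
  linear_combination key

def LD (z D : ℕ) (ι : Fin (3*z) → ℕ) (σ : Job z → ℕ) (ρ : Job z → Finset ℕ) (k t : ℕ) : ℕ :=
  ∑ j ∈ Finset.univ.filter (fun j => k ∈ ρ j ∧ σ j + pJob z D ι j ≤ t), pJob z D ι j

theorem load_full (z D : ℕ) (ι : Fin (3*z) → ℕ)
    (hz : 0 < z) (hDpos : 0 < D) (hsum : ∑ i, ι i = z * D)
    (σ : Job z → ℕ) (ρ : Job z → Finset ℕ)
    (hfeas : Feasible 4 (pJob z D ι) (qJob z) σ ρ)
    (hmk : makespan (pJob z D ι) σ = Wval z D) (k : ℕ) (hk : k ∈ Finset.Icc 1 4) :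
    ∑ j ∈ Finset.univ.filter (fun j => k ∈ ρ j), pJob z D ι j = Wval z D := by
  obtain ⟨f1, f2, f3⟩ := hfeas
  have hle : ∀ k ∈ Finset.Icc 1 4,
      ∑ j ∈ Finset.univ.filter (fun j => k ∈ ρ j), pJob z D ι j ≤ Wval z D := by
    intro k _
    refine packing (pJob z D ι) σ _ ?_ 0 (Wval z D) ?_
    · intro x hx y hy hxy
      simp only [Finset.mem_filter] at hx hy
      exact f3 x y hxy ⟨k, by simp [hx.2, hy.2]⟩
    · intro x _
      refine ⟨Nat.zero_le _, ?_⟩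
      rw [← hmk]
      exact Finset.le_sup (f := fun j => σ j + pJob z D ι j) (Finset.mem_univ x)
  have htot : ∑ k ∈ Finset.Icc 1 4, ∑ j ∈ Finset.univ.filter (fun j => k ∈ ρ j), pJob z D ι j
      = ∑ k ∈ Finset.Icc 1 4, Wval z D := by
    simp only [Finset.sum_filter]
    rw [Finset.sum_comm]
    have : ∀ j, ∑ k ∈ Finset.Icc 1 4, (if k ∈ ρ j then pJob z D ι j else 0)
        = pJob z D ι j * qJob z j := by
      intro j
      rw [← Finset.sum_filter, Finset.sum_const, smul_eq_mul, Finset.filter_mem_eq_inter,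
        Finset.inter_eq_right.2 (f1 j), f2 j, mul_comm]
    simp only [this]
    rw [total_pq z D ι hz hsum]
    simp
  exact (Finset.sum_eq_sum_iff_of_le hle).1 htot k hk

theorem load_start (z D : ℕ) (ι : Fin (3*z) → ℕ)
    (hz : 0 < z) (hDpos : 0 < D) (hsum : ∑ i, ι i = z * D)
    (σ : Job z → ℕ) (ρ : Job z → Finset ℕ)
    (hfeas : Feasible 4 (pJob z D ι) (qJob z) σ ρ)
    (hmk : makespan (pJob z D ι) σ = Wval z D) (j0 : Job z) (k : ℕ) (hk : k ∈ ρ j0)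
    (hpos : 0 < pJob z D ι j0) :
    LD z D ι σ ρ k (σ j0) = σ j0 := by
  have hfull := load_full z D ι hz hDpos hsum σ ρ hfeas hmk k (hfeas.1 j0 hk)
  obtain ⟨f1, f2, f3⟩ := hfeas
  rw [← Finset.sum_filter_add_sum_filter_not _ (fun j => σ j + pJob z D ι j ≤ σ j0),
    Finset.filter_filter, Finset.filter_filter] at hfull
  have hW : ∀ x, σ x + pJob z D ι x ≤ Wval z D := by
    intro x
    rw [← hmk]
    exact Finset.le_sup (f := fun j => σ j + pJob z D ι j) (Finset.mem_univ x)
  have h1 : LD z D ι σ ρ k (σ j0) ≤ σ j0 - 0 := by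
    refine packing (pJob z D ι) σ _ ?_ 0 (σ j0) ?_
    · intro x hx y hy hxy
      simp only [Finset.mem_filter] at hx hy
      exact f3 x y hxy ⟨k, by simp [hx.2, hy.2]⟩
    · intro x hx
      simp only [Finset.mem_filter] at hx
      exact ⟨Nat.zero_le _, hx.2.2⟩
  have h2 : ∑ j ∈ Finset.univ.filter (fun j => k ∈ ρ j ∧ ¬ (σ j + pJob z D ι j ≤ σ j0)),
      pJob z D ι j ≤ Wval z D - σ j0 := by
    refine packing (pJob z D ι) σ _ ?_ (σ j0) (Wval z D) ?_
    · intro x hx y hy hxy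
      simp only [Finset.mem_filter] at hx hy
      exact f3 x y hxy ⟨k, by simp [hx.2, hy.2]⟩
    · intro x hx
      simp only [Finset.mem_filter] at hx
      refine ⟨?_, hW x⟩
      by_cases hxj : x = j0
      · rw [hxj]
      · rcases f3 x j0 hxj ⟨k, by simp [hx.2, hk]⟩ with g | g
        · exact absurd g hx.2.2
        · omega
  have := hW j0
  unfold LD at *
  omega

def NN (z D : ℕ) (ι : Fin (3*z) → ℕ) (σ : Job z → ℕ) (ρ : Job z → Finset ℕ) (k : ℕ)
    (S : Finset (Job z)) (t : ℕ) : ℕ :=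
  FF (pJob z D ι) σ (S.filter fun j => k ∈ ρ j) t

theorem NN_def (z D : ℕ) (ι : Fin (3*z) → ℕ) (σ : Job z → ℕ) (ρ : Job z → Finset ℕ) (k : ℕ)
    (S : Finset (Job z)) (t : ℕ) : NN z D ι σ ρ k S t =
    (S.filter fun j => k ∈ ρ j ∧ σ j + pJob z D ι j ≤ t).card := by
  rw [NN, FF, Finset.filter_filter]

theorem NN_le (z D : ℕ) (ι : Fin (3*z) → ℕ) (σ : Job z → ℕ) (ρ : Job z → Finset ℕ) (k : ℕ)
    (S : Finset (Job z)) (t : ℕ) : NN z D ι σ ρ k S t ≤ S.card := by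
  rw [NN_def]; exact Finset.card_filter_le _ _

theorem prof (z D : ℕ) (ι : Fin (3*z) → ℕ) (hDpos : 0 < D)
    (hsum : ∑ i, ι i = z * D) (hhigh : ∀ i, 2 * ι i < D)
    (σ : Job z → ℕ) (ρ : Job z → Finset ℕ) (k t : ℕ) :
    ∃ X P, X ≤ 2*z*NN z D ι σ ρ k (sc z) t + 3*z*NN z D ι σ ρ k (sγ z) t
        + 3*z*NN z D ι σ ρ k (sδ z) t ∧
      P ≤ z * D ∧ P ≤ NN z D ι σ ρ k (sPart z) t * D ∧
      LD z D ι σ ρ k t + NN z D ι σ ρ k (sγ z) t * D =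
        (NN z D ι σ ρ k (sA z) t + NN z D ι σ ρ k (sβ z) t + NN z D ι σ ρ k (sl2 z) t) * D^2
      + (NN z D ι σ ρ k (sB z) t + NN z D ι σ ρ k (sα z) t + NN z D ι σ ρ k (sl1 z) t) * D^3
      + (NN z D ι σ ρ k (sa z) t + NN z D ι σ ρ k (sδ z) t + NN z D ι σ ρ k (sβ z) t) * D^4
      + (NN z D ι σ ρ k (sb z) t + NN z D ι σ ρ k (sγ z) t + NN z D ι σ ρ k (sα z) t) * D^5
      + (NN z D ι σ ρ k (sa z) t + NN z D ι σ ρ k (sb z) t) * D^6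
      + (3*z*NN z D ι σ ρ k (sa z) t + 3*z*NN z D ι σ ρ k (sb z) t + 4*z*NN z D ι σ ρ k (sα z) t
        + (4*z-1)*NN z D ι σ ρ k (sβ z) t + z*NN z D ι σ ρ k (sl1 z) t
        + 2*z*NN z D ι σ ρ k (sl2 z) t + X) * D^7
      + (NN z D ι σ ρ k (sc z) t + NN z D ι σ ρ k (sα z) t + NN z D ι σ ρ k (sβ z) t
        + NN z D ι σ ρ k (sl1 z) t + NN z D ι σ ρ k (sl2 z) t) * D^8 + P := by
  unfold LD
  rw [sum_job']
  simp only [NN_def]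
  set Q : Job z → Prop := fun j => k ∈ ρ j ∧ σ j + pJob z D ι j ≤ t with hQ
  have hconst : ∀ (S : Finset (Job z)) (v : ℕ), (∀ j ∈ S, pJob z D ι j = v) →
      ∑ j ∈ S.filter Q, pJob z D ι j = (S.filter Q).card * v := by
    intro S v hS
    rw [Finset.sum_congr rfl (fun j hj => hS j (Finset.mem_filter.1 hj).1), Finset.sum_const,
      smul_eq_mul]
  rw [hconst (sA z) (D^2) (by simp [sA, pJob]), hconst (sB z) (D^3) (by simp [sB, pJob]),
    hconst (sa z) (D^4 + D^6 + 3*z*D^7) (by simp [sa, pJob]),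
    hconst (sb z) (D^5 + D^6 + 3*z*D^7) (by simp [sb, pJob]),
    hconst (sα z) (D^3 + D^5 + 4*z*D^7 + D^8) (by simp [sα, pJob]),
    hconst (sβ z) (D^2 + D^4 + (4*z-1)*D^7 + D^8) (by simp [sβ, pJob]),
    hconst (sl1 z) (D^3 + z*D^7 + D^8) (by simp [sl1, pJob]),
    hconst (sl2 z) (D^2 + 2*z*D^7 + D^8) (by simp [sl2, pJob])]
  have hgen : ∀ (S : Finset (Job z)) (u v w B : ℕ), (∀ j ∈ S, ∃ x, x ≤ B ∧
      pJob z D ι j + w = u + x * v) →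
      ∃ X, X ≤ B * (S.filter Q).card ∧
      ∑ j ∈ S.filter Q, pJob z D ι j + (S.filter Q).card * w = (S.filter Q).card * u + X * v := by
    intro S u v w B hS
    have hS' : ∀ j, ∃ x, j ∈ S → (x ≤ B ∧ pJob z D ι j + w = u + x * v) := by
      intro j
      by_cases hj : j ∈ S
      · obtain ⟨x, hx⟩ := hS j hj
        exact ⟨x, fun _ => hx⟩
      · exact ⟨0, fun h => absurd h hj⟩
    choose f hf using hS'
    refine ⟨∑ j ∈ S.filter Q, f j, ?_, ?_⟩
    · rw [mul_comm, ← smul_eq_mul]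
      exact Finset.sum_le_card_nsmul _ _ _ (fun j hj => (hf j (Finset.mem_filter.1 hj).1).1)
    · rw [Finset.sum_mul, ← smul_eq_mul, ← smul_eq_mul, ← Finset.sum_const, ← Finset.sum_const,
        ← Finset.sum_add_distrib, ← Finset.sum_add_distrib]
      exact Finset.sum_congr rfl (fun j hj => (hf j (Finset.mem_filter.1 hj).1).2)
  obtain ⟨Xc, hXc, hXc'⟩ := hgen (sc z) (D^8) (D^7) 0 (2*z) (by
    intro j hj
    simp only [sc, Finset.mem_image, Finset.mem_univ, true_and] at hj
    obtain ⟨i, rfl⟩ := hj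
    refine ⟨z + i.val, by omega, ?_⟩
    simp only [pJob]
    ring)
  obtain ⟨Xg, hXg, hXg'⟩ := hgen (sγ z) (D^5) (D^7) D (3*z) (by
    intro j hj
    simp only [sγ, Finset.mem_image, Finset.mem_univ, true_and] at hj
    obtain ⟨i, rfl⟩ := hj
    refine ⟨3*z - (i.val+1), by omega, ?_⟩
    simp only [pJob]
    have h5 : D ≤ D^5 := Nat.le_self_pow (by norm_num) D
    omega)
  obtain ⟨Xd, hXd, hXd'⟩ := hgen (sδ z) (D^4) (D^7) 0 (3*z) (by
    intro j hj
    simp only [sδ, Finset.mem_image, Finset.mem_univ, true_and] at hj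
    obtain ⟨i, rfl⟩ := hj
    exact ⟨3*z - (i.val+1), by omega, by simp only [pJob]; ring⟩)
  refine ⟨Xc + Xg + Xd, ∑ j ∈ (sPart z).filter Q, pJob z D ι j,
    add_le_add (add_le_add hXc hXg) hXd, ?_, ?_, ?_⟩
  · rw [← hsum]
    calc _ ≤ ∑ j ∈ sPart z, pJob z D ι j :=
          Finset.sum_le_sum_of_subset (Finset.filter_subset _ _)
      _ = _ := by
          rw [sPart, Finset.sum_image (by intro x _ y _ h; injection h)]
          rfl
  · rw [← smul_eq_mul]
    refine Finset.sum_le_card_nsmul _ _ _ (fun j hj => ?_)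
    have hj := (Finset.mem_filter.1 hj).1
    simp only [sPart, Finset.mem_image, Finset.mem_univ, true_and] at hj
    obtain ⟨i, rfl⟩ := hj
    have := hhigh i
    simp only [pJob]
    omega
  · linear_combination hXc' + hXg' + hXd'

theorem card_s (z : ℕ) : (sA z).card = z+1 ∧ (sB z).card = z+1 ∧ (sa z).card = z ∧
    (sb z).card = z ∧ (sc z).card = z+1 ∧ (sα z).card = z ∧ (sβ z).card = z ∧ (sγ z).card = z ∧
    (sδ z).card = z ∧ (sl1 z).card = 1 ∧ (sl2 z).card = 1 := by
  simp only [sA, sB, sa, sb, sc, sα, sβ, sγ, sδ, sl1, sl2]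
  repeat rw [Finset.card_image_of_injective _ (by intro x y h; injection h)]
  simp

theorem dig_arith (z D T : ℕ) (hz : 0 < z) (hDpos : 0 < D) (hD : 4*z*(7*z+1) < D)
    (nA nB na nb nc nα nβ nγ nδ nl nm X P : ℕ)
    (nA' nB' na' nb' nc' nα' nβ' nγ' nδ' nl' nm' X' P' : ℕ)
    (B1 : nA ≤ z+1)
    (B2 : nB ≤ z+1)
    (B3 : na ≤ z)
    (B4 : nb ≤ z)
    (B5 : nc ≤ z+1)
    (B6 : nα ≤ z)
    (B7 : nβ ≤ z)
    (B8 : nγ ≤ z)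
    (B9 : nδ ≤ z)
    (B10 : nl ≤ 1)
    (B11 : nm ≤ 1)
    (B1' : nA' ≤ z+1)
    (B2' : nB' ≤ z+1)
    (B3' : na' ≤ z)
    (B4' : nb' ≤ z)
    (B5' : nc' ≤ z+1)
    (B6' : nα' ≤ z)
    (B7' : nβ' ≤ z)
    (B8' : nγ' ≤ z)
    (B9' : nδ' ≤ z)
    (B10' : nl' ≤ 1)
    (B11' : nm' ≤ 1)
    (b1 : X ≤ 2*z*nc + 3*z*nγ + 3*z*nδ) (b2 : P ≤ z * D)
    (e : T + nγ * D = (nA + nβ + nm) * D^2 + (nB + nα + nl) * D^3 + (na + nδ + nβ) * D^4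
      + (nb + nγ + nα) * D^5 + (na + nb) * D^6
      + (3*z*na + 3*z*nb + 4*z*nα + (4*z-1)*nβ + z*nl + 2*z*nm + X) * D^7
      + (nc + nα + nβ + nl + nm) * D^8 + P)
    (b1' : X' ≤ 2*z*nc' + 3*z*nγ' + 3*z*nδ') (b2' : P' ≤ z * D)
    (e' : T + nγ' * D = (nA' + nβ' + nm') * D^2 + (nB' + nα' + nl') * D^3 + (na' + nδ' + nβ') * D^4
      + (nb' + nγ' + nα') * D^5 + (na' + nb') * D^6
      + (3*z*na' + 3*z*nb' + 4*z*nα' + (4*z-1)*nβ' + z*nl' + 2*z*nm' + X') * D^7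
      + (nc' + nα' + nβ' + nl' + nm') * D^8 + P')
    : nA + nβ + nm = nA' + nβ' + nm' ∧ nB + nα + nl = nB' + nα' + nl' ∧
    na + nδ + nβ = na' + nδ' + nβ' ∧ nb + nγ + nα = nb' + nγ' + nα' ∧ na + nb = na' + nb' ∧
    nc + nα + nβ + nl + nm = nc' + nα' + nβ' + nl' + nm' := by
  have hDz : 32 * z ≤ 4*z*(7*z+1) := by
    have q10 : z * 1 ≤ z * z := Nat.mul_le_mul_left z hz
    linarith
  have xb : ∀ na nb nc nα nβ nγ nδ nl nm X : ℕ, na ≤ z → nb ≤ z → nc ≤ z+1 → nα ≤ z → nβ ≤ z →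
      nγ ≤ z → nδ ≤ z → nl ≤ 1 → nm ≤ 1 → X ≤ 2*z*nc + 3*z*nγ + 3*z*nδ →
      3*z*na + 3*z*nb + 4*z*nα + (4*z-1)*nβ + z*nl + 2*z*nm + X < D := by
    intro na nb nc nα nβ nγ nδ nl nm X h1 h2 h3 h4 h5 h6 h7 h8 h9 h10
    have : (4*z-1)*nβ ≤ 4*z*nβ := Nat.mul_le_mul_right _ (by omega)
    have q1 := Nat.mul_le_mul_left z h1
    have q2 := Nat.mul_le_mul_left z h2
    have q3 := Nat.mul_le_mul_left z h3
    have q4 := Nat.mul_le_mul_left z h4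
    have q5 := Nat.mul_le_mul_left z h5
    have q6 := Nat.mul_le_mul_left z h6
    have q7 := Nat.mul_le_mul_left z h7
    have q8 := Nat.mul_le_mul_left z h8
    have q9 := Nat.mul_le_mul_left z h9
    have q10 : z * 1 ≤ z * z := Nat.mul_le_mul_left z hz
    linarith
  have g3 : 2 * (z * D) < D^2 := by
    have : 2 * z < D := by omega
    calc 2 * (z * D) = (2 * z) * D := by ring
      _ < D * D := Nat.mul_lt_mul_of_pos_right this hDpos
      _ = D^2 := by ring
  have x1 := xb na nb nc nα nβ nγ nδ nl nm X B3 B4 B5 B6 B7 B8 B9 B10 B11 b1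
  have x2 := xb na' nb' nc' nα' nβ' nγ' nδ' nl' nm' X' B3' B4' B5' B6' B7' B8' B9' B10' B11' b1'
  clear xb b1 b1'
  generalize 3*z*na + 3*z*nb + 4*z*nα + (4*z-1)*nβ + z*nl + 2*z*nm + X = Y at *
  generalize 3*z*na' + 3*z*nb' + 4*z*nα' + (4*z-1)*nβ' + z*nl' + 2*z*nm' + X' = Y' at *
  have g1 : nγ * D ≤ z * D := Nat.mul_le_mul_right _ B8
  have g2 : nγ' * D ≤ z * D := Nat.mul_le_mul_right _ B8'
  have hDz' : 32 * z < D := lt_of_le_of_lt hDz hD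
  clear hDz hD
  have he : |((P + nγ' * D : ℕ) : ℤ) - ((P' + nγ * D : ℕ) : ℤ)| < (D:ℤ)^2 := by
    clear e e'
    have := abs_sub_nat_lt (P + nγ' * D) (P' + nγ * D) (D^2) (by omega) (by omega)
    rwa [Nat.cast_pow] at this
  have heq : (((P + nγ' * D : ℕ) : ℤ) - ((P' + nγ * D : ℕ) : ℤ))
    + (((nA + nβ + nm : ℕ) : ℤ) - ((nA' + nβ' + nm' : ℕ) : ℤ)) * (D:ℤ)^2
    + (((nB + nα + nl : ℕ) : ℤ) - ((nB' + nα' + nl' : ℕ) : ℤ)) * (D:ℤ)^3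
    + (((na + nδ + nβ : ℕ) : ℤ) - ((na' + nδ' + nβ' : ℕ) : ℤ)) * (D:ℤ)^4
    + (((nb + nγ + nα : ℕ) : ℤ) - ((nb' + nγ' + nα' : ℕ) : ℤ)) * (D:ℤ)^5
    + (((na + nb : ℕ) : ℤ) - ((na' + nb' : ℕ) : ℤ)) * (D:ℤ)^6
    + ((Y : ℤ) - (Y' : ℤ)) * (D:ℤ)^7
    + (((nc + nα + nβ + nl + nm : ℕ) : ℤ) - ((nc' + nα' + nβ' + nl' + nm' : ℕ) : ℤ)) * (D:ℤ)^8
    = 0 := by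
    clear he
    have e1 := congrArg (Nat.cast (R := ℤ)) e
    have e2 := congrArg (Nat.cast (R := ℤ)) e'
    clear e e'
    push_cast at e1 e2 ⊢
    linear_combination e2 - e1
  clear e e' g1 g2 g3 b2 b2'
  have := digits_int D _ _ _ _ _ _ _ _ (by omega) he
    (abs_sub_nat_lt _ _ _ (by omega) (by omega))
    (abs_sub_nat_lt _ _ _ (by omega) (by omega))
    (abs_sub_nat_lt _ _ _ (by omega) (by omega))
    (abs_sub_nat_lt _ _ _ (by omega) (by omega))
    (abs_sub_nat_lt _ _ _ (by omega) (by omega))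
    (abs_sub_nat_lt _ _ _ x1 x2) heq
  clear he heq
  omega

theorem dig (z D : ℕ) (ι : Fin (3*z) → ℕ) (hz : 0 < z) (hDpos : 0 < D)
    (hsum : ∑ i, ι i = z * D) (hhigh : ∀ i, 2 * ι i < D) (hD : 4*z*(7*z+1) < D)
    (σ : Job z → ℕ) (ρ : Job z → Finset ℕ) (k k' t : ℕ)
    (h : LD z D ι σ ρ k t = LD z D ι σ ρ k' t) :
    NN z D ι σ ρ k (sA z) t + NN z D ι σ ρ k (sβ z) t + NN z D ι σ ρ k (sl2 z) t =
      NN z D ι σ ρ k' (sA z) t + NN z D ι σ ρ k' (sβ z) t + NN z D ι σ ρ k' (sl2 z) t ∧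
    NN z D ι σ ρ k (sB z) t + NN z D ι σ ρ k (sα z) t + NN z D ι σ ρ k (sl1 z) t =
      NN z D ι σ ρ k' (sB z) t + NN z D ι σ ρ k' (sα z) t + NN z D ι σ ρ k' (sl1 z) t ∧
    NN z D ι σ ρ k (sa z) t + NN z D ι σ ρ k (sδ z) t + NN z D ι σ ρ k (sβ z) t =
      NN z D ι σ ρ k' (sa z) t + NN z D ι σ ρ k' (sδ z) t + NN z D ι σ ρ k' (sβ z) t ∧
    NN z D ι σ ρ k (sb z) t + NN z D ι σ ρ k (sγ z) t + NN z D ι σ ρ k (sα z) t =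
      NN z D ι σ ρ k' (sb z) t + NN z D ι σ ρ k' (sγ z) t + NN z D ι σ ρ k' (sα z) t ∧
    NN z D ι σ ρ k (sa z) t + NN z D ι σ ρ k (sb z) t =
      NN z D ι σ ρ k' (sa z) t + NN z D ι σ ρ k' (sb z) t ∧
    NN z D ι σ ρ k (sc z) t + NN z D ι σ ρ k (sα z) t + NN z D ι σ ρ k (sβ z) t
        + NN z D ι σ ρ k (sl1 z) t + NN z D ι σ ρ k (sl2 z) t =
      NN z D ι σ ρ k' (sc z) t + NN z D ι σ ρ k' (sα z) t + NN z D ι σ ρ k' (sβ z) t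
        + NN z D ι σ ρ k' (sl1 z) t + NN z D ι σ ρ k' (sl2 z) t := by
  obtain ⟨X, P, b1, b2, -, e⟩ := prof z D ι hDpos hsum hhigh σ ρ k t
  obtain ⟨X', P', b1', b2', -, e'⟩ := prof z D ι hDpos hsum hhigh σ ρ k' t
  rw [h] at e
  obtain ⟨c1, c2, c3, c4, c5, c6, c7, c8, c9, c10, c11⟩ := card_s z
  have bd : ∀ k, NN z D ι σ ρ k (sA z) t ≤ z+1 ∧ NN z D ι σ ρ k (sB z) t ≤ z+1 ∧
      NN z D ι σ ρ k (sa z) t ≤ z ∧ NN z D ι σ ρ k (sb z) t ≤ z ∧ NN z D ι σ ρ k (sc z) t ≤ z+1 ∧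
      NN z D ι σ ρ k (sα z) t ≤ z ∧ NN z D ι σ ρ k (sβ z) t ≤ z ∧ NN z D ι σ ρ k (sγ z) t ≤ z ∧
      NN z D ι σ ρ k (sδ z) t ≤ z ∧ NN z D ι σ ρ k (sl1 z) t ≤ 1 ∧
      NN z D ι σ ρ k (sl2 z) t ≤ 1 := by
    intro k
    refine ⟨?_, ?_, ?_, ?_, ?_, ?_, ?_, ?_, ?_, ?_, ?_⟩
    · rw [← c1]; apply NN_le
    · rw [← c2]; apply NN_le
    · exact (NN_le ..).trans c3.le
    · exact (NN_le ..).trans c4.le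
    · exact (NN_le ..).trans c5.le
    · exact (NN_le ..).trans c6.le
    · exact (NN_le ..).trans c7.le
    · exact (NN_le ..).trans c8.le
    · exact (NN_le ..).trans c9.le
    · exact (NN_le ..).trans c10.le
    · exact (NN_le ..).trans c11.le
  obtain ⟨B1, B2, B3, B4, B5, B6, B7, B8, B9, B10, B11⟩ := bd k
  obtain ⟨B1', B2', B3', B4', B5', B6', B7', B8', B9', B10', B11'⟩ := bd k'
  exact dig_arith z D _ hz hDpos hD _ _ _ _ _ _ _ _ _ _ _ X P _ _ _ _ _ _ _ _ _ _ _ X' P'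
    B1 B2 B3 B4 B5 B6 B7 B8 B9 B10 B11 B1' B2' B3' B4' B5' B6' B7' B8' B9' B10' B11'
    b1 b2 e b1' b2' e'

theorem NN_all {z D : ℕ} {ι : Fin (3*z) → ℕ} {σ : Job z → ℕ} {ρ : Job z → Finset ℕ} {k : ℕ}
    {S : Finset (Job z)} (h : ∀ j ∈ S, k ∈ ρ j) (t : ℕ) :
    NN z D ι σ ρ k S t = FF (pJob z D ι) σ S t := by
  rw [NN, Finset.filter_true_of_mem h]

theorem NN_none {z D : ℕ} {ι : Fin (3*z) → ℕ} {σ : Job z → ℕ} {ρ : Job z → Finset ℕ} {k : ℕ}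
    {S : Finset (Job z)} (h : ∀ j ∈ S, k ∉ ρ j) (t : ℕ) :
    NN z D ι σ ρ k S t = 0 := by
  rw [NN, Finset.filter_false_of_mem h]; rfl

theorem mem_s {z : ℕ} (f : Fin z → Job z) (P : Job z → Prop) (h : ∀ i, P (f i)) :
    ∀ j ∈ Finset.univ.image f, P j := by
  intro j hj
  simp only [Finset.mem_image, Finset.mem_univ, true_and] at hj
  obtain ⟨i, rfl⟩ := hj
  exact h i

theorem single_not {s : Finset ℕ} {k m : ℕ} (h : s.card = 1) (hk : k ∈ s) (hm : m ≠ k) :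
    m ∉ s := by
  obtain ⟨x, rfl⟩ := Finset.card_eq_one.1 h
  simp only [Finset.mem_singleton] at *
  omega

def mk23 : Bool → ℕ := fun k => if k then 2 else 3

theorem pJob_pos (z D : ℕ) (ι : Fin (3*z) → ℕ) (hD : 2 ≤ D) (hι : ∀ i, 0 < ι i) (j : Job z) :
    0 < pJob z D ι j := by
  have h2 : 0 < D^2 := by positivity
  have h3 : 0 < D^3 := by positivity
  have h4 : 0 < D^4 := by positivity
  have h8 : 0 < D^8 := by positivity
  have h5 : D < D^5 := by
    calc D = D^1 := (pow_one D).symm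
      _ < D^5 := Nat.pow_lt_pow_right (by omega) (by norm_num)
  cases j <;> simp only [pJob] <;> first | omega | exact hι _

theorem mkSys
    (z D : ℕ) (ι : Fin (3*z) → ℕ)
    (hz : 0 < z) (hDpos : 0 < D)
    (hιpos : ∀ i, 0 < ι i)
    (hsum : ∑ i, ι i = z * D)
    (hhigh : ∀ i, 2 * ι i < D)
    (hD : 4*z*(7*z+1) < D)
    (σ : Job z → ℕ) (ρ : Job z → Finset ℕ)
    (hfeas : Feasible 4 (pJob z D ι) (qJob z) σ ρ)
    (hmk : makespan (pJob z D ι) σ = Wval z D)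
    (hnf : NormalForm ρ) :
    Sys (pJob z D ι) σ z (sA z) (sB z) (sc z) (sa z) (sb z) (sα z) (sβ z) (sl1 z) (sl2 z)
      (fun k => (sa z).filter (fun j => mk23 k ∈ ρ j))
      (fun k => (sb z).filter (fun j => mk23 k ∈ ρ j))
      (fun k => (sγ z).filter (fun j => mk23 k ∈ ρ j))
      (fun k => (sδ z).filter (fun j => mk23 k ∈ ρ j)) := by
  have hD2 : 2 ≤ D := by
    have : 4 * 1 * 1 ≤ 4*z*(7*z+1) := by gcongr <;> omega
    omega
  have hpos := pJob_pos z D ι hD2 hιpos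
  have hst : ∀ j k k', k ∈ ρ j → k' ∈ ρ j → LD z D ι σ ρ k (σ j) = LD z D ι σ ρ k' (σ j) := by
    intro j k k' hk hk'
    rw [load_start z D ι hz hDpos hsum σ ρ hfeas hmk j k hk (hpos j),
      load_start z D ι hz hDpos hsum σ ρ hfeas hmk j k' hk' (hpos j)]
  obtain ⟨f1, f2, f3⟩ := hfeas
  obtain ⟨n1, n4, n23, none⟩ := hnf
  have both : ∀ j, BothM23 j → ∀ k, mk23 k ∈ ρ j := by
    intro j hj k
    cases k
    · exact (n23 j hj).2
    · exact (n23 j hj).1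
  have one : ∀ j, OneM23 j → ∃ k, mk23 k ∈ ρ j := by
    intro j hj
    by_cases h : 2 ∈ ρ j
    · exact ⟨true, h⟩
    · refine ⟨false, ?_⟩
      by_contra h3
      exact h ((none j hj).2 h3)
  have dBB : ∀ x y, x ≠ y → BothM23 x → BothM23 y → DJ (pJob z D ι) σ x y := by
    intro x y hxy hx hy
    exact f3 x y hxy ⟨2, by simp [(n23 x hx).1, (n23 y hy).1]⟩
  have dBO : ∀ x y, x ≠ y → BothM23 x → OneM23 y → DJ (pJob z D ι) σ x y := by
    intro x y hxy hx hy
    obtain ⟨k, hk⟩ := one y hy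
    exact f3 x y hxy ⟨mk23 k, by simp [both x hx k, hk]⟩
  have d1 : ∀ x y, x ≠ y → M1Jobs x → M1Jobs y → DJ (pJob z D ι) σ x y := by
    intro x y hxy hx hy
    exact f3 x y hxy ⟨1, by simp [(n1 x).2 hx, (n1 y).2 hy]⟩
  have d4 : ∀ x y, x ≠ y → M4Jobs x → M4Jobs y → DJ (pJob z D ι) σ x y := by
    intro x y hxy hx hy
    exact f3 x y hxy ⟨4, by simp [(n4 x).2 hx, (n4 y).2 hy]⟩
  have mA : ∀ j ∈ sA z, ∃ i, j = Job.JA i := by simp [sA, eq_comm]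
  have mB : ∀ j ∈ sB z, ∃ i, j = Job.JB i := by simp [sB, eq_comm]
  have ma : ∀ j ∈ sa z, ∃ i, j = Job.Ja i := by simp [sa, eq_comm]
  have mb : ∀ j ∈ sb z, ∃ i, j = Job.Jb i := by simp [sb, eq_comm]
  have mc : ∀ j ∈ sc z, ∃ i, j = Job.Jc i := by simp [sc, eq_comm]
  have mα : ∀ j ∈ sα z, ∃ i, j = Job.Jα i := by simp [sα, eq_comm]
  have mβ : ∀ j ∈ sβ z, ∃ i, j = Job.Jβ i := by simp [sβ, eq_comm]
  have mγ : ∀ j ∈ sγ z, ∃ i, j = Job.Jγ i := by simp [sγ, eq_comm]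
  have mδ : ∀ j ∈ sδ z, ∃ i, j = Job.Jδ i := by simp [sδ, eq_comm]
  have ml : ∀ j ∈ sl1 z, j = Job.Jl1 := by simp [sl1]
  have mm : ∀ j ∈ sl2 z, j = Job.Jl2 := by simp [sl2]
  have nk1 : ∀ j, M1Jobs j → qJob z j = 1 → ∀ k, mk23 k ∉ ρ j := by
    intro j h1 hq k
    exact single_not ((f2 j).trans hq) ((n1 j).2 h1) (by cases k <;> simp [mk23])
  have nk4 : ∀ j, M4Jobs j → qJob z j = 1 → ∀ k, mk23 k ∉ ρ j := by
    intro j h1 hq k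
    exact single_not ((f2 j).trans hq) ((n4 j).2 h1) (by cases k <;> simp [mk23])
  -- classes on machine k
  have kA : ∀ k, ∀ j ∈ sA z, mk23 k ∈ ρ j := by
    intro k j hj; obtain ⟨i, rfl⟩ := mA j hj; exact both (.JA i) trivial k
  have kB : ∀ k, ∀ j ∈ sB z, mk23 k ∈ ρ j := by
    intro k j hj; obtain ⟨i, rfl⟩ := mB j hj; exact both (.JB i) trivial k
  have kc : ∀ k, ∀ j ∈ sc z, mk23 k ∈ ρ j := by
    intro k j hj; obtain ⟨i, rfl⟩ := mc j hj; exact both (.Jc i) trivial k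
  have kα : ∀ k, ∀ j ∈ sα z, mk23 k ∉ ρ j := by
    intro k j hj; obtain ⟨i, rfl⟩ := mα j hj; exact nk1 (.Jα i) trivial rfl k
  have kβ : ∀ k, ∀ j ∈ sβ z, mk23 k ∉ ρ j := by
    intro k j hj; obtain ⟨i, rfl⟩ := mβ j hj; exact nk4 (.Jβ i) trivial rfl k
  have kl : ∀ k, ∀ j ∈ sl1 z, mk23 k ∉ ρ j := by
    intro k j hj; rw [ml j hj]; exact nk1 .Jl1 trivial rfl k
  have km : ∀ k, ∀ j ∈ sl2 z, mk23 k ∉ ρ j := by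
    intro k j hj; rw [mm j hj]; exact nk4 .Jl2 trivial rfl k
  have k1A : ∀ j ∈ sA z, 1 ∈ ρ j := by
    intro j hj; obtain ⟨i, rfl⟩ := mA j hj; exact (n1 _).2 trivial
  have k1a : ∀ j ∈ sa z, 1 ∈ ρ j := by
    intro j hj; obtain ⟨i, rfl⟩ := ma j hj; exact (n1 _).2 trivial
  have k1α : ∀ j ∈ sα z, 1 ∈ ρ j := by
    intro j hj; obtain ⟨i, rfl⟩ := mα j hj; exact (n1 _).2 trivial
  have k1l : ∀ j ∈ sl1 z, 1 ∈ ρ j := by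
    intro j hj; rw [ml j hj]; exact (n1 _).2 trivial
  have k1B : ∀ j ∈ sB z, 1 ∉ ρ j := by
    intro j hj; obtain ⟨i, rfl⟩ := mB j hj; exact fun h => (n1 _).1 h
  have k1b : ∀ j ∈ sb z, 1 ∉ ρ j := by
    intro j hj; obtain ⟨i, rfl⟩ := mb j hj; exact fun h => (n1 _).1 h
  have k1c : ∀ j ∈ sc z, 1 ∉ ρ j := by
    intro j hj; obtain ⟨i, rfl⟩ := mc j hj; exact fun h => (n1 _).1 h
  have k1β : ∀ j ∈ sβ z, 1 ∉ ρ j := by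
    intro j hj; obtain ⟨i, rfl⟩ := mβ j hj; exact fun h => (n1 _).1 h
  have k1γ : ∀ j ∈ sγ z, 1 ∉ ρ j := by
    intro j hj; obtain ⟨i, rfl⟩ := mγ j hj; exact fun h => (n1 _).1 h
  have k1δ : ∀ j ∈ sδ z, 1 ∉ ρ j := by
    intro j hj; obtain ⟨i, rfl⟩ := mδ j hj; exact fun h => (n1 _).1 h
  have k1m : ∀ j ∈ sl2 z, 1 ∉ ρ j := by
    intro j hj; rw [mm j hj]; exact fun h => (n1 _).1 h
  have k4B : ∀ j ∈ sB z, 4 ∈ ρ j := by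
    intro j hj; obtain ⟨i, rfl⟩ := mB j hj; exact (n4 _).2 trivial
  have k4b : ∀ j ∈ sb z, 4 ∈ ρ j := by
    intro j hj; obtain ⟨i, rfl⟩ := mb j hj; exact (n4 _).2 trivial
  have k4β : ∀ j ∈ sβ z, 4 ∈ ρ j := by
    intro j hj; obtain ⟨i, rfl⟩ := mβ j hj; exact (n4 _).2 trivial
  have k4m : ∀ j ∈ sl2 z, 4 ∈ ρ j := by
    intro j hj; rw [mm j hj]; exact (n4 _).2 trivial
  have k4A : ∀ j ∈ sA z, 4 ∉ ρ j := by
    intro j hj; obtain ⟨i, rfl⟩ := mA j hj; exact fun h => (n4 _).1 h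
  have k4a : ∀ j ∈ sa z, 4 ∉ ρ j := by
    intro j hj; obtain ⟨i, rfl⟩ := ma j hj; exact fun h => (n4 _).1 h
  have k4c : ∀ j ∈ sc z, 4 ∉ ρ j := by
    intro j hj; obtain ⟨i, rfl⟩ := mc j hj; exact fun h => (n4 _).1 h
  have k4α : ∀ j ∈ sα z, 4 ∉ ρ j := by
    intro j hj; obtain ⟨i, rfl⟩ := mα j hj; exact fun h => (n4 _).1 h
  have k4γ : ∀ j ∈ sγ z, 4 ∉ ρ j := by
    intro j hj; obtain ⟨i, rfl⟩ := mγ j hj; exact fun h => (n4 _).1 h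
  have k4δ : ∀ j ∈ sδ z, 4 ∉ ρ j := by
    intro j hj; obtain ⟨i, rfl⟩ := mδ j hj; exact fun h => (n4 _).1 h
  have k4l : ∀ j ∈ sl1 z, 4 ∉ ρ j := by
    intro j hj; rw [ml j hj]; exact fun h => (n4 _).1 h
  have E1 : ∀ k t, LD z D ι σ ρ 1 t = LD z D ι σ ρ (mk23 k) t →
      FF (pJob z D ι) σ (sB z) t = FF (pJob z D ι) σ (sc z) t ∧
      FF (pJob z D ι) σ (sc z) t = FF (pJob z D ι) σ (sα z) t + FF (pJob z D ι) σ (sl1 z) t ∧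
      NN z D ι σ ρ (mk23 k) (sa z) t + NN z D ι σ ρ (mk23 k) (sδ z) t
        = FF (pJob z D ι) σ (sa z) t ∧
      NN z D ι σ ρ (mk23 k) (sb z) t + NN z D ι σ ρ (mk23 k) (sγ z) t
        = FF (pJob z D ι) σ (sα z) t ∧
      NN z D ι σ ρ (mk23 k) (sa z) t + NN z D ι σ ρ (mk23 k) (sb z) t
        = FF (pJob z D ι) σ (sa z) t := by
    intro k t h
    have := dig z D ι hz hDpos hsum hhigh hD σ ρ 1 (mk23 k) t h
    rw [NN_all k1A, NN_all k1a, NN_all k1α, NN_all k1l, NN_none k1B, NN_none k1b, NN_none k1c,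
      NN_none k1β, NN_none k1γ, NN_none k1δ, NN_none k1m, NN_all (kA k), NN_all (kB k),
      NN_all (kc k), NN_none (kα k), NN_none (kβ k), NN_none (kl k), NN_none (km k)] at this
    omega
  have E4 : ∀ k t, LD z D ι σ ρ 4 t = LD z D ι σ ρ (mk23 k) t →
      FF (pJob z D ι) σ (sA z) t = FF (pJob z D ι) σ (sc z) t ∧
      FF (pJob z D ι) σ (sc z) t = FF (pJob z D ι) σ (sβ z) t + FF (pJob z D ι) σ (sl2 z) t ∧
      NN z D ι σ ρ (mk23 k) (sb z) t + NN z D ι σ ρ (mk23 k) (sγ z) t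
        = FF (pJob z D ι) σ (sb z) t ∧
      NN z D ι σ ρ (mk23 k) (sa z) t + NN z D ι σ ρ (mk23 k) (sδ z) t
        = FF (pJob z D ι) σ (sβ z) t ∧
      NN z D ι σ ρ (mk23 k) (sb z) t + NN z D ι σ ρ (mk23 k) (sa z) t
        = FF (pJob z D ι) σ (sb z) t := by
    intro k t h
    have := dig z D ι hz hDpos hsum hhigh hD σ ρ 4 (mk23 k) t h
    rw [NN_none k4A, NN_none k4a, NN_none k4α, NN_none k4l, NN_all k4B, NN_all k4b, NN_none k4c,
      NN_all k4β, NN_none k4γ, NN_none k4δ, NN_all k4m, NN_all (kA k), NN_all (kB k),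
      NN_all (kc k), NN_none (kα k), NN_none (kβ k), NN_none (kl k), NN_none (km k)] at this
    omega
  have hsum2 : ∀ S : Finset (Job z), (∀ j ∈ S, OneM23 j) → ∀ t,
      FF (pJob z D ι) σ (S.filter (fun j => mk23 true ∈ ρ j)) t +
      FF (pJob z D ι) σ (S.filter (fun j => mk23 false ∈ ρ j)) t = FF (pJob z D ι) σ S t := by
    intro S hS t
    change FF (pJob z D ι) σ (S.filter (fun j => 2 ∈ ρ j)) t +
      FF (pJob z D ι) σ (S.filter (fun j => 3 ∈ ρ j)) t = FF (pJob z D ι) σ S t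
    unfold FF
    rw [Finset.filter_filter, Finset.filter_filter]
    rw [← Finset.card_filter_add_card_filter_not (s := S.filter (fun j => σ j + pJob z D ι j ≤ t))
      (fun j => 2 ∈ ρ j), Finset.filter_filter, Finset.filter_filter]
    congr 2
    · ext j
      simp only [Finset.mem_filter]
      tauto
    · ext j
      simp only [Finset.mem_filter]
      constructor
      · rintro ⟨h1, h2, h3⟩
        exact ⟨h1, h3, fun h => (none j (hS j h1)).1 h h2⟩
      · rintro ⟨h1, h2, h3⟩
        refine ⟨h1, ?_, h2⟩
        by_contra h4
        exact h3 ((none j (hS j h1)).2 h4)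
  obtain ⟨c1, c2, c3, c4, c5, c6, c7, c8, c9, c10, c11⟩ := card_s z
  exact
  { pos := hpos
    dAA := by
      intro x hx y hy hxy
      obtain ⟨i, rfl⟩ := mA x hx; obtain ⟨i', rfl⟩ := mA y hy
      exact dBB _ _ hxy trivial trivial
    dBB := by
      intro x hx y hy hxy
      obtain ⟨i, rfl⟩ := mB x hx; obtain ⟨i', rfl⟩ := mB y hy
      exact dBB _ _ hxy trivial trivial
    daa := by
      intro x hx y hy hxy
      obtain ⟨i, rfl⟩ := ma x hx; obtain ⟨i', rfl⟩ := ma y hy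
      exact d1 _ _ hxy trivial trivial
    dbb := by
      intro x hx y hy hxy
      obtain ⟨i, rfl⟩ := mb x hx; obtain ⟨i', rfl⟩ := mb y hy
      exact d4 _ _ hxy trivial trivial
    dAB := by
      intro x hx y hy
      obtain ⟨i, rfl⟩ := mA x hx; obtain ⟨i', rfl⟩ := mB y hy
      exact dBB _ _ (by simp) trivial trivial
    dAC := by
      intro x hx y hy
      obtain ⟨i, rfl⟩ := mA x hx; obtain ⟨i', rfl⟩ := mc y hy
      exact dBB _ _ (by simp) trivial trivial
    dBC := by
      intro x hx y hy
      obtain ⟨i, rfl⟩ := mB x hx; obtain ⟨i', rfl⟩ := mc y hy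
      exact dBB _ _ (by simp) trivial trivial
    dAa := by
      intro x hx y hy
      obtain ⟨i, rfl⟩ := mA x hx; obtain ⟨i', rfl⟩ := ma y hy
      exact dBO _ _ (by simp) trivial trivial
    dAb := by
      intro x hx y hy
      obtain ⟨i, rfl⟩ := mA x hx; obtain ⟨i', rfl⟩ := mb y hy
      exact dBO _ _ (by simp) trivial trivial
    dBa := by
      intro x hx y hy
      obtain ⟨i, rfl⟩ := mB x hx; obtain ⟨i', rfl⟩ := ma y hy
      exact dBO _ _ (by simp) trivial trivial
    dBb := by
      intro x hx y hy
      obtain ⟨i, rfl⟩ := mB x hx; obtain ⟨i', rfl⟩ := mb y hy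
      exact dBO _ _ (by simp) trivial trivial
    dCa := by
      intro x hx y hy
      obtain ⟨i, rfl⟩ := mc x hx; obtain ⟨i', rfl⟩ := ma y hy
      exact dBO _ _ (by simp) trivial trivial
    dCb := by
      intro x hx y hy
      obtain ⟨i, rfl⟩ := mc x hx; obtain ⟨i', rfl⟩ := mb y hy
      exact dBO _ _ (by simp) trivial trivial
    ska := by
      intro x hx
      obtain ⟨k, hk⟩ := one x (by obtain ⟨i, rfl⟩ := ma x hx; trivial)
      exact ⟨k, Finset.mem_filter.2 ⟨hx, hk⟩⟩
    skb := by
      intro x hx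
      obtain ⟨k, hk⟩ := one x (by obtain ⟨i, rfl⟩ := mb x hx; trivial)
      exact ⟨k, Finset.mem_filter.2 ⟨hx, hk⟩⟩
    iska := fun k x hx => (Finset.mem_filter.1 hx).1
    iskb := fun k x hx => (Finset.mem_filter.1 hx).1
    suma := hsum2 _ (by intro j hj; obtain ⟨i, rfl⟩ := ma j hj; trivial)
    sumb := hsum2 _ (by intro j hj; obtain ⟨i, rfl⟩ := mb j hj; trivial)
    stA := by
      intro x hx
      have h := fun k => E1 k (σ x) (hst x 1 (mk23 k) (k1A x hx) (kA k x hx))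
      exact ⟨(h true).1, (h true).2.1, fun k => ⟨(h k).2.2.2.1, (h k).2.2.2.2⟩⟩
    stB := by
      intro x hx
      have h := fun k => E4 k (σ x) (hst x 4 (mk23 k) (k4B x hx) (kB k x hx))
      exact ⟨(h true).1, (h true).2.1, fun k => ⟨(h k).2.2.2.1, (h k).2.2.2.2⟩⟩
    sta := by
      intro k x hx
      obtain ⟨hx, hk⟩ := Finset.mem_filter.1 hx
      have h := E1 k (σ x) (hst x 1 (mk23 k) (k1a x hx) hk)
      exact ⟨h.1, h.2.1, h.2.2.1, h.2.2.2.2⟩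
    stb := by
      intro k x hx
      obtain ⟨hx, hk⟩ := Finset.mem_filter.1 hx
      have h := E4 k (σ x) (hst x 4 (mk23 k) (k4b x hx) hk)
      exact ⟨h.1, h.2.1, h.2.2.1, h.2.2.2.2⟩
    stC := by
      intro x hx
      have h := dig z D ι hz hDpos hsum hhigh hD σ ρ (mk23 true) (mk23 false) (σ x)
        (hst x _ _ (kc true x hx) (kc false x hx))
      exact h.2.2.2.2.1
    cA := c1, cB := c2, ca := c3, cb := c4, cα := c6, cβ := c7, cL := c10, cM := c11 }

theorem load1 (z D : ℕ) (ι : Fin (3*z) → ℕ) (hDpos : 0 < D)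
    (hsum : ∑ i, ι i = z * D) (hhigh : ∀ i, 2 * ι i < D)
    (σ : Job z → ℕ) (ρ : Job z → Finset ℕ) (n1 : ∀ j, 1 ∈ ρ j ↔ M1Jobs j) (t i : ℕ)
    (hA : FF (pJob z D ι) σ (sA z) t = i) (ha : FF (pJob z D ι) σ (sa z) t = i)
    (hα : FF (pJob z D ι) σ (sα z) t = i) (hL : FF (pJob z D ι) σ (sl1 z) t = 1) :
    LD z D ι σ ρ 1 t = i*D^2 + (i+1)*D^3 + i*D^4 + i*D^5 + i*D^6 +
        (7*z*i + z)*D^7 + (i+1)*D^8 := by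
  obtain ⟨X, P, hX, -, hP, e⟩ := prof z D ι hDpos hsum hhigh σ ρ 1 t
  rw [NN_all (S := sA z) (by simp [sA, n1, M1Jobs]), NN_all (S := sa z) (by simp [sa, n1, M1Jobs]),
    NN_all (S := sα z) (by simp [sα, n1, M1Jobs]), NN_all (S := sl1 z) (by simp [sl1, n1, M1Jobs]),
    NN_none (S := sB z) (by simp [sB, n1, M1Jobs]), NN_none (S := sb z) (by simp [sb, n1, M1Jobs]),
    NN_none (S := sc z) (by simp [sc, n1, M1Jobs]), NN_none (S := sβ z) (by simp [sβ, n1, M1Jobs]),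
    NN_none (S := sγ z) (by simp [sγ, n1, M1Jobs]), NN_none (S := sδ z) (by simp [sδ, n1, M1Jobs]),
    NN_none (S := sl2 z) (by simp [sl2, n1, M1Jobs]), hA, ha, hα, hL] at e
  rw [NN_none (S := sc z) (by simp [sc, n1, M1Jobs]),
    NN_none (S := sγ z) (by simp [sγ, n1, M1Jobs]),
    NN_none (S := sδ z) (by simp [sδ, n1, M1Jobs])] at hX
  rw [NN_none (S := sPart z) (by simp [sPart, n1, M1Jobs])] at hP
  have hX0 : X = 0 := by omega
  have hP0 : P = 0 := by omega
  subst hX0 hP0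
  linear_combination e

theorem FF_enum {J : Type} [DecidableEq J] (p σ : J → ℕ) (pos : ∀ j, 0 < p j) (z : ℕ)
    (S : Finset J) (hc : S.card = z + 1) (hS : ∀ x ∈ S, ∀ y ∈ S, x ≠ y → DJ p σ x y)
    (e : Fin (z+1) → J) (hmem : ∀ i, e i ∈ S) (hinj : Function.Injective e)
    (hmono : Monotone fun i => σ (e i)) (i : Fin (z+1)) : FF p σ S (σ (e i)) = i.val := by
  have himg : Finset.univ.image e = S := by
    apply Finset.eq_of_subset_of_card_le
    · intro x hx
      simp only [Finset.mem_image, Finset.mem_univ, true_and] at hx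
      obtain ⟨i, rfl⟩ := hx
      exact hmem i
    · rw [Finset.card_image_of_injective _ hinj, hc]; simp
  have : S.filter (fun j => σ j + p j ≤ σ (e i)) = (Finset.Iio i).image e := by
    rw [← himg]
    ext x
    simp only [Finset.mem_filter, Finset.mem_image, Finset.mem_univ, true_and, Finset.mem_Iio]
    constructor
    · rintro ⟨⟨k, rfl⟩, h⟩
      refine ⟨k, ?_, rfl⟩
      by_contra! hk
      have := hmono hk
      have := pos (e k)
      simp only at *
      omega
    · rintro ⟨k, hk, rfl⟩
      refine ⟨⟨k, rfl⟩, ?_⟩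
      rcases hS _ (hmem k) _ (hmem i) (fun h => hk.ne (hinj h)) with g | g
      · exact g
      · have := hmono hk.le
        have := pos (e i)
        simp only at *
        omega
  rw [FF, this, Finset.card_image_of_injective _ hinj, Fin.card_Iio]

end Concrete

/-- Machine 1 processes its jobs in the order
`λ₁, A₀, a⁽¹⁾, α⁽¹⁾, A₁, …, a⁽ᶻ⁾, α⁽ᶻ⁾, A_z`; consequently
`σ(Aᵢ) = iD² + (i+1)D³ + iD⁴ + iD⁵ + iD⁶ + (7zi+z)D⁷ + (i+1)D⁸`. -/
theorem machine1_order
    (z D : ℕ) (ι : Fin (3*z) → ℕ)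
    (hz : 0 < z) (hDpos : 0 < D)
    (hιpos : ∀ i, 0 < ι i)
    (hsum : ∑ i, ι i = z * D)
    (hlow : ∀ i, D < 4 * ι i)
    (hhigh : ∀ i, 2 * ι i < D)
    (hD : 4*z*(7*z+1) < D)
    (σ : Job z → ℕ) (ρ : Job z → Finset ℕ)
    (hfeas : Feasible 4 (pJob z D ι) (qJob z) σ ρ)
    (hmk : makespan (pJob z D ι) σ = Wval z D)
    (hnf : NormalForm ρ)
    (Aenum : Fin (z+1) → Job z)
    (hAmem : ∀ i, Aenum i ∈ sA z)
    (hAinj : Function.Injective Aenum)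
    (hAmono : Monotone fun i => σ (Aenum i))
    (hfirst : ∃ j ∈ sB z, 2 ∈ ρ j ∧ σ j = 0) :
    σ Job.Jl1 = 0 ∧
    (∀ i : Fin (z+1),
      σ (Aenum i) = i.val*D^2 + (i.val+1)*D^3 + i.val*D^4 + i.val*D^5 + i.val*D^6 +
        (7*z*i.val + z)*D^7 + (i.val+1)*D^8) ∧
    (∀ i : Fin z, ∃ a' ∈ sa z, ∃ α' ∈ sα z,
      σ a' = σ (Aenum i.castSucc) + D^2 ∧
      σ α' = σ a' + pJob z D ι a' ∧
      σ (Aenum i.succ) = σ α' + pJob z D ι α') := by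
  have S := mkSys z D ι hz hDpos hιpos hsum hhigh hD σ ρ hfeas hmk hnf
  have hcount := FF_enum (pJob z D ι) σ S.pos z (sA z) S.cA S.dAA Aenum hAmem hAinj hAmono
  have hload : ∀ j, 1 ∈ ρ j → LD z D ι σ ρ 1 (σ j) = σ j := fun j hj =>
    load_start z D ι hz hDpos hsum σ ρ hfeas hmk j 1 hj (S.pos j)
  have n1 := hnf.1
  have h1A : ∀ j ∈ sA z, 1 ∈ ρ j := by simp [sA, n1, M1Jobs]
  have hpA : ∀ j ∈ sA z, pJob z D ι j = D^2 := by simp [sA, pJob]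
  have hpa : ∀ j ∈ sa z, pJob z D ι j = D^4 + D^6 + 3*z*D^7 := by simp [sa, pJob]
  have hpα : ∀ j ∈ sα z, pJob z D ι j = D^3 + D^5 + 4*z*D^7 + D^8 := by simp [sα, pJob]
  have hnext : ∀ (i : ℕ) (h : i + 1 < z + 1), σ (Aenum ⟨i, by omega⟩)
      + pJob z D ι (Aenum ⟨i, by omega⟩) ≤ σ (Aenum ⟨i+1, h⟩) := by
    intro i h
    rcases S.dAA _ (hAmem ⟨i, by omega⟩) _ (hAmem ⟨i+1, h⟩)
      (fun h => by have := hAinj h; simp at this) with g | g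
    · exact g
    · have h1 : σ (Aenum ⟨i, by omega⟩) ≤ σ (Aenum ⟨i+1, h⟩) :=
        hAmono (a := ⟨i, by omega⟩) (b := ⟨i+1, h⟩) (by simp [Fin.le_def])
      have := S.pos (Aenum ⟨i+1, h⟩)
      omega
  have main : ∀ (i : ℕ) (h : i < z + 1),
      FF (pJob z D ι) σ (sB z) (σ (Aenum ⟨i, h⟩)) = i + 1 ∧
      FF (pJob z D ι) σ (sa z) (σ (Aenum ⟨i, h⟩)) = i ∧
      FF (pJob z D ι) σ (sα z) (σ (Aenum ⟨i, h⟩)) = i ∧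
      FF (pJob z D ι) σ (sl1 z) (σ (Aenum ⟨i, h⟩)) = 1 := by
    intro i
    induction i with
    | zero =>
      intro h
      obtain ⟨y, hy, -, hy0⟩ := hfirst
      exact S.base (hAmem _) hy hy0 (hcount _)
    | succ i ih =>
      intro h
      obtain ⟨g1, g2, g3, g4⟩ := ih (by omega)
      obtain ⟨q1, q2, q3, q4, -⟩ := S.step (i := i) (hAmem _) (hAmem _) (hnext i h)
        (hcount _) (hcount _) (by omega) g1 g2 g4
      exact ⟨q1, q2, q3, q4⟩
  have form : ∀ i : Fin (z+1),
      σ (Aenum i) = i.val*D^2 + (i.val+1)*D^3 + i.val*D^4 + i.val*D^5 + i.val*D^6 +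
        (7*z*i.val + z)*D^7 + (i.val+1)*D^8 := by
    intro i
    obtain ⟨g1, g2, g3, g4⟩ := main i.val i.isLt
    rw [← hload _ (h1A _ (hAmem i))]
    exact load1 z D ι hDpos hsum hhigh σ ρ n1 _ _ (hcount i) g2 g3 g4
  refine ⟨?_, form, ?_⟩
  · obtain ⟨g1, g2, g3, g4⟩ := main 0 (by omega)
    have hf := form ⟨0, by omega⟩
    have hl : 0 < FF (pJob z D ι) σ (sl1 z) (σ (Aenum ⟨0, by omega⟩)) := by omega
    obtain ⟨j, hj⟩ := Finset.card_pos.1 hl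
    simp only [sl1, Finset.mem_filter, Finset.mem_singleton] at hj
    obtain ⟨rfl, hj⟩ := hj
    rw [hf] at hj
    simp only [pJob] at hj
    ring_nf at hj
    omega
  · intro i
    obtain ⟨g1, g2, g3, g4⟩ := main i.val (by omega)
    obtain ⟨u, hu, v, hv, r1, r2, r3⟩ := S.final (i := i.val) (hAmem _) (hAmem _) (hnext i.val (by omega))
      (hcount _) (hcount _) (by omega) g1 g2 g3 g4 (by
        intro x hx y hy
        refine hfeas.2.2 x y ?_ ⟨1, ?_⟩
        · rintro rfl
          simp only [sa, sα, Finset.mem_image] at hx hy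
          obtain ⟨_, _, rfl⟩ := hx
          obtain ⟨_, _, h⟩ := hy
          cases h
        · have h1 : 1 ∈ ρ x := by
            revert x; simp [sa, n1, M1Jobs]
          have h2 : 1 ∈ ρ y := by
            revert y; simp [sα, n1, M1Jobs]
          simp [h1, h2])
    refine ⟨u, hu, v, hv, ?_⟩
    have e1 := form i.castSucc
    have e2 := form i.succ
    have r1' : σ (Aenum i.castSucc) + pJob z D ι (Aenum i.castSucc) ≤ σ u := r1
    have r3' : σ v + pJob z D ι v ≤ σ (Aenum i.succ) := r3
    rw [hpA _ (hAmem _)] at r1'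
    rw [hpa _ hu] at r2 ⊢
    rw [hpα _ hv] at r3' ⊢
    have e3 : σ (Aenum i.succ) = σ (Aenum i.castSucc) + D^2 + (D^4 + D^6 + 3*z*D^7)
        + (D^3 + D^5 + 4*z*D^7 + D^8) := by
      rw [e1, e2, Fin.val_succ, Fin.val_castSucc]
      ring
    clear e1 e2
    refine ⟨?_, ?_, ?_⟩ <;> omega
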